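/- Let H be a finite-dimensional complex Hilbert space. Let f:(0,∞)→(0,∞) be a strictly monotone decreasing, strictly convex function with lim_{ε→0⁺} f(ε)=+∞, and let g:[0,∞)→[0,∞) be a strictly monotone increasing continuous function with g(0)=0 and lim_{t→∞} g(t)=∞ which is either strictly convex or strictly concave. If φ: S(H) → S(H) is a map (not assumed bijective) satisfying D'_{f,g}(φ(A)‖φ(B)) = D'_{f,g}(A‖B) for all A, B ∈ S(H), then there exists a unitary operator U on H such that either φ(A) = U A U* for all A ∈ S(H), or φ(A) = U Aᵀ U* for all A ∈ S(H) (where Aᵀ denotes the transpose with respect to a fixed orthonormal basis; the second case corresponds to an antiunitary similarity). -/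

import Mathlib

open Matrix
open scoped ComplexOrder

/-- Apply a real function to (the eigenvalues of) a Hermitian matrix via the
spectral decomposition (functional calculus); junk value `0` otherwise. -/
noncomputable def matFun {n : ℕ} (h : ℝ → ℝ) (A : Matrix (Fin n) (Fin n) ℂ) :
    Matrix (Fin n) (Fin n) ℂ :=
  if hA : A.IsHermitian then hA.cfc h else 0

/-- The (real part of the) trace of a complex matrix. -/
noncomputable def retr {n : ℕ} (M : Matrix (Fin n) (Fin n) ℂ) : ℝ := M.trace.re

/-- Real power of a positive semidefinite matrix via the spectral decomposition. -/
noncomputable def rpowMat {n : ℕ} (A : Matrix (Fin n) (Fin n) ℂ) (r : ℝ) :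
    Matrix (Fin n) (Fin n) ℂ := matFun (fun t => t ^ r) A

/-- Density operators: positive semidefinite matrices of trace `1`. -/
def Density (n : ℕ) := {A : Matrix (Fin n) (Fin n) ℂ // A.PosSemidef ∧ A.trace = 1}

/-- `supp A ⊆ supp B`, i.e. the range of `A` is contained in the range of `B`. -/
def suppLE {n : ℕ} (A B : Matrix (Fin n) (Fin n) ℂ) : Prop :=
  LinearMap.range (Matrix.toLin' A) ≤ LinearMap.range (Matrix.toLin' B)

/-- `supp A ⟂ supp B`: the ranges of `A` and `B` are orthogonal. -/
def suppOrth {n : ℕ} (A B : Matrix (Fin n) (Fin n) ℂ) : Prop :=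
  ∀ x y : Fin n → ℂ, star (A.mulVec x) ⬝ᵥ B.mulVec y = 0

/-- The extension `f₀` of `f : (0,∞) → (0,∞)` to `[0,∞)` with `f₀ 0 = 0`. -/
noncomputable def extZero (f : ℝ → ℝ) : ℝ → ℝ := fun t => if 0 < t then f t else 0

/-- The generalized divergence `D'_{f,g}(A‖B) = tr g(f₀(B) A f₀(B))` (real-valued version,
used when `lim_{ε→0⁺} f(ε) = 0`). -/
noncomputable def Dfg {n : ℕ} (f g : ℝ → ℝ) (A B : Matrix (Fin n) (Fin n) ℂ) : ℝ :=
  retr (matFun g (matFun (extZero f) B * A * matFun (extZero f) B))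

open scoped Classical in
/-- The generalized divergence `D'_{f,g}(A‖B)`: equal to `tr g(f₀(B) A f₀(B))` if
`supp A ⊆ supp B` and `∞` otherwise (used when `lim_{ε→0⁺} f(ε) = ∞`). -/
noncomputable def DfgE {n : ℕ} (f g : ℝ → ℝ) (A B : Matrix (Fin n) (Fin n) ℂ) : EReal :=
  if suppLE A B then ((Dfg f g A B : ℝ) : EReal) else ⊤

open scoped Classical in
/-- The quantum Rényi divergence `D_α(A‖B)` of density operators `A, B`
(with the convention `tr A = 1`), with values in the extended reals. -/
noncomputable def Dalpha {n : ℕ} (α : ℝ) (A B : Matrix (Fin n) (Fin n) ℂ) : EReal :=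
  if (α < 1 ∧ ¬ suppOrth A B) ∨ (1 < α ∧ suppLE A B) then
    (((α - 1)⁻¹ * Real.log (retr (rpowMat
      (rpowMat B ((1 - α) / (2 * α)) * A * rpowMat B ((1 - α) / (2 * α))) α)) : ℝ) : EReal)
  else ⊤

/-- The quantum Rényi divergence on the cone of positive definite matrices
(a finite real number there). -/
noncomputable def DalphaPD {n : ℕ} (α : ℝ) (A B : Matrix (Fin n) (Fin n) ℂ) : ℝ :=
  (α - 1)⁻¹ * Real.log ((retr A)⁻¹ * retr (rpowMat
    (rpowMat B ((1 - α) / (2 * α)) * A * rpowMat B ((1 - α) / (2 * α))) α))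

/-- Rank-one (orthogonal) projections: `P = x ⊗ x` for a unit vector `x`. -/
def IsRankOneProj {n : ℕ} (P : Matrix (Fin n) (Fin n) ℂ) : Prop :=
  ∃ x : Fin n → ℂ, star x ⬝ᵥ x = 1 ∧ P = Matrix.vecMulVec x (star x)

/-- The rank-one matrix `x ⊗ x`. -/
def rankOne {n : ℕ} (x : Fin n → ℂ) : Matrix (Fin n) (Fin n) ℂ := vecMulVec x (star x)

/-- The family `u` is an orthonormal basis of `Fin n → ℂ`. -/
structure IsONB {n : ℕ} (u : Fin n → Fin n → ℂ) : Prop where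
  inner : ∀ i j, star (u i) ⬝ᵥ u j = if i = j then 1 else 0
  sum : ∑ i, rankOne (u i) = 1

section rankOne

variable {n : ℕ}

lemma rankOne_isHermitian (x : Fin n → ℂ) : (rankOne x).IsHermitian := by
  simp [rankOne, Matrix.IsHermitian, conjTranspose_vecMulVec]

lemma rankOne_mulVec (x y : Fin n → ℂ) : rankOne x *ᵥ y = (star x ⬝ᵥ y) • x := by
  ext i
  simp [rankOne, vecMulVec_mulVec, mul_comm]

lemma rankOne_mul_rankOne (x y : Fin n → ℂ) :
    rankOne x * rankOne y = (star x ⬝ᵥ y) • vecMulVec x (star y) := by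
  simp [rankOne, vecMulVec_mul_vecMulVec, vecMulVec_smul]

lemma trace_rankOne (x : Fin n → ℂ) : (rankOne x).trace = star x ⬝ᵥ x := by
  rw [rankOne, trace_vecMulVec, dotProduct_comm]

lemma trace_rankOne_mul (x : Fin n → ℂ) (M : Matrix (Fin n) (Fin n) ℂ) :
    (rankOne x * M).trace = star x ⬝ᵥ M *ᵥ x := by
  rw [rankOne, vecMulVec_mul, trace_vecMulVec, dotProduct_comm, ← dotProduct_mulVec]

lemma rankOne_posSemidef (x : Fin n → ℂ) : (rankOne x).PosSemidef :=
  posSemidef_vecMulVec_self_star x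

lemma mul_rankOne_mul {F : Matrix (Fin n) (Fin n) ℂ} (hF : F.IsHermitian) (x : Fin n → ℂ) :
    F * rankOne x * F = rankOne (F *ᵥ x) := by
  rw [rankOne, rankOne, mul_vecMulVec, vecMulVec_mul, star_mulVec, hF.eq]

/-- A rank-one density operator. -/
def rankOneDensity (x : Fin n → ℂ) (hx : star x ⬝ᵥ x = 1) : Density n :=
  ⟨rankOne x, rankOne_posSemidef x, by rw [trace_rankOne, hx]⟩

lemma exists_unit_smul {x : Fin n → ℂ} (hx : x ≠ 0) :
    ∃ (c : ℂ) (y : Fin n → ℂ), c ≠ 0 ∧ x = c • y ∧ star y ⬝ᵥ y = 1 := by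
  have h0 : (0 : ℂ) ≤ star x ⬝ᵥ x := dotProduct_star_self_nonneg x
  have hne : star x ⬝ᵥ x ≠ 0 := by
    intro h
    exact hx (dotProduct_star_self_eq_zero.1 h)
  obtain ⟨r, hr⟩ : ∃ r : ℝ, star x ⬝ᵥ x = r := ⟨(star x ⬝ᵥ x).re, (Complex.eq_re_of_ofReal_le h0)⟩
  rw [hr] at h0 hne
  have hr0 : 0 < r := lt_of_le_of_ne (by exact_mod_cast h0) (by
    intro h; apply hne; rw [← h]; simp)
  have hs : (0 : ℝ) < Real.sqrt r := Real.sqrt_pos.2 hr0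
  have hsc : ((Real.sqrt r : ℝ) : ℂ) ≠ 0 := by exact_mod_cast hs.ne'
  refine ⟨(Real.sqrt r : ℝ), ((Real.sqrt r : ℝ) : ℂ)⁻¹ • x, hsc, ?_, ?_⟩
  · rw [smul_smul, mul_inv_cancel₀ hsc, one_smul]
  · simp only [star_smul, smul_dotProduct, dotProduct_smul, hr, smul_eq_mul]
    have : (r : ℂ) = (Real.sqrt r : ℝ) * (Real.sqrt r : ℝ) := by
      rw [← Complex.ofReal_mul, Real.mul_self_sqrt hr0.le]
    rw [this]
    simp
    field_simp

lemma eq_zero_of_forall_unit {Z : Matrix (Fin n) (Fin n) ℂ}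
    (h : ∀ x : Fin n → ℂ, star x ⬝ᵥ x = 1 → star x ⬝ᵥ Z *ᵥ x = 0) : Z = 0 := by
  have h' : ∀ x : Fin n → ℂ, star x ⬝ᵥ Z *ᵥ x = 0 := by
    intro x
    by_cases hx : x = 0
    · simp [hx]
    obtain ⟨c, y, hc, rfl, hy⟩ := exists_unit_smul hx
    simp [mulVec_smul, h y hy]
  have key : ∀ x y : Fin n → ℂ, star x ⬝ᵥ Z *ᵥ y = 0 := by
    intro x y
    have h1 := h' (x + y)
    have h2 := h' (x + Complex.I • y)
    simp only [star_add, mulVec_add, add_dotProduct, dotProduct_add, h', mulVec_smul, star_smul,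
      smul_dotProduct, dotProduct_smul, smul_eq_mul, Complex.star_def, Complex.conj_I] at h1 h2
    have h3 : Complex.I * (star x ⬝ᵥ Z *ᵥ y - star y ⬝ᵥ Z *ᵥ x) = 0 := by linear_combination h2
    have h4 := (mul_eq_zero.1 h3).resolve_left Complex.I_ne_zero
    linear_combination (1/2) * h1 + (1/2) * h4
  ext i j
  have := key (Pi.single i 1) (Pi.single j 1)
  simpa [Pi.star_single] using this

lemma span_rankOne_eq_top :
    Submodule.span ℂ {M : Matrix (Fin n) (Fin n) ℂ | ∃ x, star x ⬝ᵥ x = 1 ∧ M = rankOne x} = ⊤ := by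
  set S := Submodule.span ℂ {M : Matrix (Fin n) (Fin n) ℂ | ∃ x, star x ⬝ᵥ x = 1 ∧ M = rankOne x}
  have h1 : ∀ x : Fin n → ℂ, rankOne x ∈ S := by
    intro x
    by_cases hx : x = 0
    · simp [hx, rankOne]
    obtain ⟨c, y, hc, rfl, hy⟩ := exists_unit_smul hx
    have : rankOne (c • y) = (c * star c) • rankOne y := by
      simp [rankOne, vecMulVec_smul, smul_smul, mul_comm]
    rw [this]
    exact S.smul_mem _ (Submodule.subset_span ⟨y, hy, rfl⟩)
  have h2 : ∀ x y : Fin n → ℂ, vecMulVec x (star y) ∈ S := by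
    intro x y
    have : vecMulVec x (star y) = (1/2 : ℂ) • (rankOne (x + y) - rankOne x - rankOne y)
        + (Complex.I / 2) • (rankOne (x + Complex.I • y) - rankOne x - rankOne y) := by
      ext i j
      simp [rankOne, vecMulVec_apply]
      ring_nf
      simp
      ring
    rw [this]
    exact S.add_mem (S.smul_mem _ (S.sub_mem (S.sub_mem (h1 _) (h1 _)) (h1 _)))
      (S.smul_mem _ (S.sub_mem (S.sub_mem (h1 _) (h1 _)) (h1 _)))
  rw [eq_top_iff]
  intro M _
  rw [matrix_eq_sum_single M]
  refine S.sum_mem fun i _ => S.sum_mem fun j _ => ?_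
  have : single i j (M i j) =
      M i j • vecMulVec (Pi.single i (1:ℂ)) (star (Pi.single j (1 : ℂ))) := by
    ext a b
    simp [single_apply, vecMulVec_apply, Pi.single_apply]
    grind
  rw [this]
  exact S.smul_mem _ (h2 _ _)

lemma eq_zero_of_trace_rankOne_mul {Z : Matrix (Fin n) (Fin n) ℂ}
    (h : ∀ x : Fin n → ℂ, star x ⬝ᵥ x = 1 → (rankOne x * Z).trace = 0) : Z = 0 :=
  eq_zero_of_forall_unit fun x hx => by rw [← trace_rankOne_mul, h x hx]

end rankOne

section spectral

variable {n : ℕ} {A : Matrix (Fin n) (Fin n) ℂ}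

lemma IsONB.expand {u : Fin n → Fin n → ℂ} (hu : IsONB u) (v : Fin n → ℂ) :
    v = ∑ i, (star (u i) ⬝ᵥ v) • u i := by
  have := congrArg (fun M => M *ᵥ v) hu.sum
  simp only [sum_mulVec, rankOne_mulVec, one_mulVec] at this
  exact this.symm

lemma IsONB.ext {u : Fin n → Fin n → ℂ} (hu : IsONB u) {M N : Matrix (Fin n) (Fin n) ℂ}
    (h : ∀ i, M *ᵥ u i = N *ᵥ u i) : M = N := by
  have h2 : ∀ i, M * rankOne (u i) = N * rankOne (u i) := by
    intro i
    rw [rankOne, mul_vecMulVec, mul_vecMulVec, h i]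
  calc M = M * ∑ i, rankOne (u i) := by rw [hu.sum, mul_one]
    _ = N * ∑ i, rankOne (u i) := by
      rw [Finset.mul_sum, Finset.mul_sum]; exact Finset.sum_congr rfl fun i _ => h2 i
    _ = N := by rw [hu.sum, mul_one]

lemma IsONB.sum_smul_mulVec {u : Fin n → Fin n → ℂ} (hu : IsONB u) (c : Fin n → ℂ) (j : Fin n) :
    (∑ i, c i • rankOne (u i)) *ᵥ u j = c j • u j := by
  simp [sum_mulVec, smul_mulVec, rankOne_mulVec, hu.inner]

lemma IsONB.of_inner {u : Fin n → Fin n → ℂ}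
    (h : ∀ i j, star (u i) ⬝ᵥ u j = if i = j then 1 else 0) : IsONB u := by
  refine ⟨h, ?_⟩
  have h1 : (of u)ᴴᵀ * (of u)ᵀ = 1 := by
    ext i j
    simp only [mul_apply, transpose_apply, conjTranspose_apply, of_apply, one_apply]
    exact h i j
  have h2 := mul_eq_one_comm.1 h1
  rw [← h2]
  ext i j
  simp [rankOne, mul_apply, Matrix.sum_apply, vecMulVec_apply]

lemma Matrix.IsHermitian.exists_spectral (hA : A.IsHermitian) :
    ∃ (u : Fin n → Fin n → ℂ) (l : Fin n → ℝ), IsONB u ∧ (∀ i, A *ᵥ u i = (l i : ℂ) • u i) ∧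
      A = ∑ i, (l i : ℂ) • rankOne (u i) ∧
      ∀ h : ℝ → ℝ, matFun h A = ∑ i, ((h (l i) : ℝ) : ℂ) • rankOne (u i) := by
  set U := (hA.eigenvectorUnitary : Matrix (Fin n) (Fin n) ℂ) with hU
  have hU1 : star U * U = 1 := Unitary.coe_star_mul_self hA.eigenvectorUnitary
  have hD : ∀ d : Fin n → ℂ, U * diagonal d * star U = ∑ i, d i • rankOne (Uᵀ i) := by
    intro d
    ext a b
    simp [mul_apply, sum_apply, rankOne, vecMulVec_apply, diagonal_apply]
    exact Finset.sum_congr rfl fun i _ => by ring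
  have hu : IsONB (fun i => Uᵀ i) := IsONB.of_inner fun i j => by
    have := congrFun (congrFun hU1 i) j
    simpa [mul_apply, one_apply, dotProduct] using this
  have hA2 : A = ∑ i, (hA.eigenvalues i : ℂ) • rankOne (Uᵀ i) := by
    rw [← hD fun i => (hA.eigenvalues i : ℂ)]
    conv_lhs => rw [hA.spectral_theorem]
    rfl
  refine ⟨fun i => Uᵀ i, hA.eigenvalues, hu, ?_, hA2, ?_⟩
  · intro i
    conv_lhs => rw [hA2]
    exact hu.sum_smul_mulVec _ i
  · intro h
    rw [← hD fun i => ((h (hA.eigenvalues i) : ℝ) : ℂ), matFun, dif_pos hA, Matrix.IsHermitian.cfc]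
    rfl

lemma isHermitian_sum_rankOne (u : Fin n → Fin n → ℂ) (l : Fin n → ℝ) :
    (∑ i, (l i : ℂ) • rankOne (u i)).IsHermitian := by
  rw [Matrix.IsHermitian, conjTranspose_sum]
  refine Finset.sum_congr rfl fun i _ => ?_
  rw [conjTranspose_smul, (rankOne_isHermitian _).eq]
  simp

lemma matFun_isHermitian (h : ℝ → ℝ) (A : Matrix (Fin n) (Fin n) ℂ) :
    (matFun h A).IsHermitian := by
  by_cases hA : A.IsHermitian
  · obtain ⟨u, l, -, -, -, hf⟩ := hA.exists_spectral
    rw [hf]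
    exact isHermitian_sum_rankOne _ _
  · simp [matFun, hA]

lemma matFun_mulVec (hA : A.IsHermitian) {v : Fin n → ℂ} {c : ℝ} (hv : A *ᵥ v = (c : ℂ) • v)
    (h : ℝ → ℝ) : matFun h A *ᵥ v = ((h c : ℝ) : ℂ) • v := by
  obtain ⟨u, l, hu, he, hA2, hf⟩ := hA.exists_spectral
  have hz : ∀ i, (l i : ℂ) * (star (u i) ⬝ᵥ v) = c * (star (u i) ⬝ᵥ v) := by
    intro i
    have h1 : star (u i) ⬝ᵥ A *ᵥ v = (l i : ℂ) * (star (u i) ⬝ᵥ v) := by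
      rw [dotProduct_mulVec, ← hA.eq, ← star_mulVec, he i]
      simp
    rw [← h1, hv]; simp
  rw [hf, sum_mulVec]
  conv_rhs => rw [hu.expand v, Finset.smul_sum]
  refine Finset.sum_congr rfl fun i _ => ?_
  rw [smul_mulVec, rankOne_mulVec]
  by_cases h0 : star (u i) ⬝ᵥ v = 0
  · simp [h0]
  · have := mul_right_cancel₀ h0 (hz i)
    rw [show l i = c by exact_mod_cast this]

lemma eigen_of_matFun_mulVec (hA : A.PosSemidef) {v : Fin n → ℂ} {c : ℝ} {h : ℝ → ℝ}
    (hc : 0 ≤ c) (hinj : Set.InjOn h (Set.Ici 0))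
    (hv : matFun h A *ᵥ v = ((h c : ℝ) : ℂ) • v) : A *ᵥ v = (c : ℂ) • v := by
  obtain ⟨u, l, hu, he, hA2, hf⟩ := hA.isHermitian.exists_spectral
  have hl : ∀ i, 0 ≤ l i := by
    intro i
    have := hA.dotProduct_mulVec_nonneg (u i)
    rw [he i, dotProduct_smul, hu.inner i i] at this
    simpa using this
  have hz : ∀ i, ((h (l i) : ℝ) : ℂ) * (star (u i) ⬝ᵥ v) = (h c : ℝ) * (star (u i) ⬝ᵥ v) := by
    intro i
    have h1 : star (u i) ⬝ᵥ matFun h A *ᵥ v = ((h (l i) : ℝ) : ℂ) * (star (u i) ⬝ᵥ v) := by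
      rw [dotProduct_mulVec, ← (matFun_isHermitian h A).eq, ← star_mulVec,
        matFun_mulVec hA.isHermitian (he i)]
      simp
    rw [← h1, hv]; simp
  conv_lhs => rw [hA2, sum_mulVec]
  conv_rhs => rw [hu.expand v, Finset.smul_sum]
  refine Finset.sum_congr rfl fun i _ => ?_
  rw [smul_mulVec, rankOne_mulVec]
  by_cases h0 : star (u i) ⬝ᵥ v = 0
  · simp [h0]
  · have h1 := mul_right_cancel₀ h0 (hz i)
    have h2 : h (l i) = h c := by exact_mod_cast h1
    rw [hinj (hl i) hc h2]

lemma Matrix.PosSemidef.exists_spectral (hA : A.PosSemidef) :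
    ∃ (u : Fin n → Fin n → ℂ) (l : Fin n → ℝ), IsONB u ∧ (∀ i, 0 ≤ l i) ∧
      (∀ i, A *ᵥ u i = (l i : ℂ) • u i) ∧
      A = ∑ i, (l i : ℂ) • rankOne (u i) ∧
      ∀ h : ℝ → ℝ, matFun h A = ∑ i, ((h (l i) : ℝ) : ℂ) • rankOne (u i) := by
  obtain ⟨u, l, hu, he, hA2, hf⟩ := hA.isHermitian.exists_spectral
  refine ⟨u, l, hu, fun i => ?_, he, hA2, hf⟩
  have := hA.dotProduct_mulVec_nonneg (u i)
  rw [he i, dotProduct_smul, hu.inner i i] at this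
  simpa using this

lemma matFun_sum_rankOne {u : Fin n → Fin n → ℂ} (hu : IsONB u) (l : Fin n → ℝ) (h : ℝ → ℝ) :
    matFun h (∑ i, (l i : ℂ) • rankOne (u i)) = ∑ i, ((h (l i) : ℝ) : ℂ) • rankOne (u i) :=
  hu.ext fun i => by
    rw [hu.sum_smul_mulVec, matFun_mulVec (isHermitian_sum_rankOne u l) (hu.sum_smul_mulVec _ i)]

end spectral

section divergence

variable {n : ℕ}

lemma retr_matFun_rankOne {g : ℝ → ℝ} (hg0 : g 0 = 0) (v : Fin n → ℂ) :
    retr (matFun g (rankOne v)) = g (star v ⬝ᵥ v).re := by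
  obtain ⟨u, l, hu, hl, he, hA, hf⟩ := (rankOne_posSemidef v).exists_spectral
  obtain ⟨s, hs⟩ : ∃ s : ℝ, star v ⬝ᵥ v = s :=
    ⟨(star v ⬝ᵥ v).re, Complex.eq_re_of_ofReal_le (dotProduct_star_self_nonneg v)⟩
  have htr : ∀ c : Fin n → ℝ, retr (∑ i, (c i : ℂ) • rankOne (u i)) = ∑ i, c i := by
    intro c
    simp [retr, trace_sum, trace_smul, trace_rankOne, hu.inner]
  have hsum : ∑ i, l i = s := by
    rw [← htr l, ← hA, retr, trace_rankOne, hs, Complex.ofReal_re]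
  have hquad : ∀ i, l i * l i = s * l i := by
    intro i
    have h1 : rankOne v *ᵥ (rankOne v *ᵥ u i) = (s : ℂ) • (rankOne v *ᵥ u i) := by
      rw [rankOne_mulVec v (u i), mulVec_smul, rankOne_mulVec, hs, smul_comm]
    rw [he i, mulVec_smul, he i] at h1
    have h2 := congrArg (fun w => star (u i) ⬝ᵥ w) h1
    simp only [dotProduct_smul, hu.inner, if_true, smul_eq_mul, mul_one] at h2
    exact_mod_cast h2
  rw [hf, htr fun i => g (l i), hs, Complex.ofReal_re]
  by_cases h0 : s = 0
  · have : ∀ i, l i = 0 := fun i => by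
      have := hquad i
      rw [h0, zero_mul] at this
      exact mul_self_eq_zero.1 this
    simp [this, hg0, h0]
  · have : ∀ i, g (l i) = g s / s * l i := fun i => by
      by_cases hi : l i = 0
      · simp [hi, hg0]
      · rw [mul_right_cancel₀ hi (hquad i)]
        field_simp
    simp only [this]
    rw [← Finset.mul_sum, hsum]
    field_simp

lemma matFun_mul_self {B : Matrix (Fin n) (Fin n) ℂ} (hB : B.IsHermitian) (h : ℝ → ℝ) :
    matFun h B * matFun h B = matFun (fun t => h t ^ 2) B := by
  obtain ⟨u, l, hu, he, -, -⟩ := hB.exists_spectral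
  refine hu.ext fun i => ?_
  rw [← mulVec_mulVec, matFun_mulVec hB (he i), mulVec_smul, matFun_mulVec hB (he i),
    matFun_mulVec hB (he i), smul_smul]
  push_cast
  rw [sq]

lemma Dfg_rankOne (f : ℝ → ℝ) {g : ℝ → ℝ} (hg0 : g 0 = 0) (x : Fin n → ℂ)
    {B : Matrix (Fin n) (Fin n) ℂ} (hB : B.IsHermitian) :
    Dfg f g (rankOne x) B = g (star x ⬝ᵥ matFun (fun t => extZero f t ^ 2) B *ᵥ x).re := by
  have hF := matFun_isHermitian (extZero f) B
  rw [Dfg, mul_rankOne_mul hF, retr_matFun_rankOne hg0, ← matFun_mul_self hB, star_mulVec, hF.eq,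
    ← dotProduct_mulVec, mulVec_mulVec]

lemma posSemidef_matFun_sq {B : Matrix (Fin n) (Fin n) ℂ} (hB : B.IsHermitian) (h : ℝ → ℝ) :
    (matFun (fun t => h t ^ 2) B).PosSemidef := by
  rw [← matFun_mul_self hB]
  have := posSemidef_conjTranspose_mul_self (matFun h B)
  rwa [(matFun_isHermitian h B).eq] at this

lemma quadForm_eq_ofReal {M : Matrix (Fin n) (Fin n) ℂ} (hM : M.PosSemidef) (x : Fin n → ℂ) :
    ∃ r : ℝ, 0 ≤ r ∧ star x ⬝ᵥ M *ᵥ x = r := by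
  have h := hM.dotProduct_mulVec_nonneg x
  have h2 := Complex.eq_re_of_ofReal_le h
  exact ⟨_, by rw [h2] at h; exact_mod_cast h, h2⟩

lemma suppLE_iff {A B : Matrix (Fin n) (Fin n) ℂ} :
    suppLE A B ↔ ∀ x, ∃ y, B *ᵥ y = A *ᵥ x := by
  simp only [suppLE, SetLike.le_def, LinearMap.mem_range, toLin'_apply]
  constructor
  · intro h x
    exact h ⟨x, rfl⟩
  · rintro h _ ⟨x, rfl⟩
    exact h x

lemma suppLE_rankOne_iff {x : Fin n → ℂ} (hx : star x ⬝ᵥ x = 1) {B : Matrix (Fin n) (Fin n) ℂ} :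
    suppLE (rankOne x) B ↔ ∃ y, B *ᵥ y = x := by
  rw [suppLE_iff]
  constructor
  · intro h
    simpa [rankOne_mulVec, hx] using h x
  · rintro ⟨y, hy⟩ w
    exact ⟨(star x ⬝ᵥ w) • y, by rw [mulVec_smul, hy, rankOne_mulVec]⟩

lemma exists_mulVec_eq_iff {B : Matrix (Fin n) (Fin n) ℂ} (hB : B.IsHermitian)
    {u : Fin n → Fin n → ℂ} {l : Fin n → ℝ} (hu : IsONB u)
    (he : ∀ i, B *ᵥ u i = (l i : ℂ) • u i) {x : Fin n → ℂ} :
    (∃ y, B *ᵥ y = x) ↔ ∀ i, l i = 0 → star (u i) ⬝ᵥ x = 0 := by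
  constructor
  · rintro ⟨y, rfl⟩ i hi
    rw [dotProduct_mulVec, ← hB.eq, ← star_mulVec, he i, hi]
    simp
  · intro h
    refine ⟨∑ i, ((l i : ℂ)⁻¹ * (star (u i) ⬝ᵥ x)) • u i, ?_⟩
    conv_rhs => rw [hu.expand x]
    rw [mulVec_sum]
    refine Finset.sum_congr rfl fun i _ => ?_
    rw [mulVec_smul, he i, smul_smul]
    by_cases hi : l i = 0
    · simp [h i hi]
    · have : (l i : ℂ) ≠ 0 := by exact_mod_cast hi
      field_simp

end divergence

section chain

variable {n : ℕ}

lemma posSemidef_sum_rankOne (u : Fin n → Fin n → ℂ) {w : Fin n → ℝ} (hw : ∀ i, 0 ≤ w i) :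
    (∑ i, (w i : ℂ) • rankOne (u i)).PosSemidef :=
  posSemidef_sum _ fun i _ => (rankOne_posSemidef (u i)).smul (by exact_mod_cast hw i)

lemma trace_sum_rankOne {u : Fin n → Fin n → ℂ} (hu : IsONB u) (w : Fin n → ℂ) :
    (∑ i, w i • rankOne (u i)).trace = ∑ i, w i := by
  simp [trace_sum, trace_smul, trace_rankOne, hu.inner]

/-- The density operator with eigenbasis `u` and eigenvalues `w`. -/
def diagDensity {u : Fin n → Fin n → ℂ} (hu : IsONB u) (w : Fin n → ℝ) (hw : ∀ i, 0 ≤ w i)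
    (hw1 : ∑ i, w i = 1) : Density n :=
  ⟨∑ i, (w i : ℂ) • rankOne (u i), posSemidef_sum_rankOne u hw, by
    rw [trace_sum_rankOne hu]; exact_mod_cast hw1⟩

lemma suppLE_sum_rankOne_iff {u : Fin n → Fin n → ℂ} (hu : IsONB u) (w w' : Fin n → ℝ) :
    suppLE (∑ i, (w i : ℂ) • rankOne (u i)) (∑ i, (w' i : ℂ) • rankOne (u i)) ↔
      ∀ i, w' i = 0 → w i = 0 := by
  have key : ∀ x i, star (u i) ⬝ᵥ (∑ i, (w i : ℂ) • rankOne (u i)) *ᵥ x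
      = w i * (star (u i) ⬝ᵥ x) := by
    intro x i
    rw [dotProduct_mulVec, ← (isHermitian_sum_rankOne u w).eq, ← star_mulVec,
      hu.sum_smul_mulVec]
    simp
  simp only [suppLE_iff, exists_mulVec_eq_iff (isHermitian_sum_rankOne u w') hu
    (fun i => hu.sum_smul_mulVec (fun i => (w' i : ℂ)) i), key]
  constructor
  · intro h i hi
    have := h (u i) i hi
    rw [hu.inner] at this
    simpa using this
  · intro h x i hi
    simp [h i hi]

lemma Density.ne_zero (A : Density n) : A.1 ≠ 0 := by
  intro h
  have := A.2.2
  rw [h] at this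
  simp at this

/-- The dimension of the support. -/
noncomputable def suppDim (A : Matrix (Fin n) (Fin n) ℂ) : ℕ :=
  Module.finrank ℂ (LinearMap.range (Matrix.toLin' A))

lemma suppDim_lt {A B : Matrix (Fin n) (Fin n) ℂ} (h1 : suppLE A B) (h2 : ¬ suppLE B A) :
    suppDim A < suppDim B :=
  Submodule.finrank_lt_finrank_of_lt (lt_of_le_not_ge h1 h2)

lemma suppDim_le (A : Matrix (Fin n) (Fin n) ℂ) : suppDim A ≤ n := by
  have := Submodule.finrank_le (LinearMap.range (Matrix.toLin' A))
  simpa [suppDim] using this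

lemma one_le_suppDim (A : Density n) : 1 ≤ suppDim A.1 := by
  rw [Nat.one_le_iff_ne_zero]
  intro h
  have h1 := Submodule.finrank_eq_zero.1 h
  rw [LinearMap.range_eq_bot] at h1
  exact A.ne_zero ((Matrix.toLin').map_eq_zero_iff.1 h1)

lemma exists_onb_rankOne {m : ℕ} {x : Fin (m + 1) → ℂ} (hx : star x ⬝ᵥ x = 1) :
    ∃ u : Fin (m + 1) → Fin (m + 1) → ℂ, IsONB u ∧ rankOne (u 0) = rankOne x := by
  obtain ⟨u, l, hu, hl, he, hA, -⟩ := (rankOne_posSemidef x).exists_spectral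
  obtain ⟨i, hi⟩ : ∃ i, l i ≠ 0 := by
    by_contra! h
    simp only [h, Complex.ofReal_zero, zero_smul, Finset.sum_const_zero] at hA
    have := trace_rankOne x
    rw [hA, hx] at this
    simp at this
  have hi' : (l i : ℂ) ≠ 0 := by exact_mod_cast hi
  have h1 : u i = ((l i : ℂ)⁻¹ * (star x ⬝ᵥ u i)) • x := by
    have := he i
    rw [rankOne_mulVec] at this
    rw [mul_smul, this, smul_smul, inv_mul_cancel₀ hi', one_smul]
  generalize (l i : ℂ)⁻¹ * (star x ⬝ᵥ u i) = c at h1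
  have h2 : star c * c = 1 := by
    have := hu.inner i i
    rw [h1] at this
    simpa [hx, mul_comm] using this
  have h3 : rankOne (u i) = rankOne x := by
    rw [h1]
    have : rankOne (c • x) = (star c * c) • rankOne x := by
      simp [rankOne, vecMulVec_smul, smul_smul]
    rw [this, h2, one_smul]
  refine ⟨fun j => u (Equiv.swap 0 i j), IsONB.of_inner fun a b => ?_, by simpa using h3⟩
  simp [hu.inner]

lemma exists_eq_rankOne_of_suppDim (A : Density n) (h : suppDim A.1 = 1) :
    ∃ y, star y ⬝ᵥ y = 1 ∧ A.1 = rankOne y := by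
  obtain ⟨u, l, hu, hl, he, hA, -⟩ := A.2.1.exists_spectral
  obtain ⟨i, hi⟩ : ∃ i, l i ≠ 0 := by
    by_contra! h
    simp only [h, Complex.ofReal_zero, zero_smul, Finset.sum_const_zero] at hA
    exact A.ne_zero hA
  obtain ⟨⟨w, hw⟩, hw0, hspan⟩ := finrank_eq_one_iff'.1 h
  have hmem : ∀ j, l j ≠ 0 → ∃ c : ℂ, c • w = u j := by
    intro j hj
    have hj' : (l j : ℂ) ≠ 0 := by exact_mod_cast hj
    have : u j ∈ LinearMap.range (Matrix.toLin' A.1) :=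
      ⟨(l j : ℂ)⁻¹ • u j, by rw [toLin'_apply, mulVec_smul, he, smul_smul,
        inv_mul_cancel₀ hj', one_smul]⟩
    obtain ⟨c, hc⟩ := hspan ⟨u j, this⟩
    exact ⟨c, congrArg Subtype.val hc⟩
  have hne : ∀ j, u j ≠ 0 := fun j hj => by
    have := hu.inner j j
    rw [hj] at this
    simp at this
  have hz : ∀ j, j ≠ i → l j = 0 := by
    intro j hji
    by_contra hj
    obtain ⟨a, ha⟩ := hmem i hi
    obtain ⟨b, hb⟩ := hmem j hj
    have h1 := hu.inner j i
    rw [if_neg hji, ← ha, ← hb] at h1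
    simp only [star_smul, smul_dotProduct, dotProduct_smul, smul_eq_mul, mul_eq_zero,
      star_eq_zero] at h1
    rcases h1 with h1 | h1 | h1
    · exact hne i (by rw [← ha, h1, zero_smul])
    · exact hne j (by rw [← hb, h1, zero_smul])
    · exact hne j (by rw [← hb, dotProduct_star_self_eq_zero.1 h1, smul_zero])
  have hA' : A.1 = (l i : ℂ) • rankOne (u i) := by
    conv_lhs => rw [hA]
    exact Finset.sum_eq_single i (fun j _ hj => by simp [hz j hj]) (by simp)
  have htr := A.2.2
  rw [hA', trace_smul, trace_rankOne, hu.inner] at htr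
  refine ⟨u i, by simp [hu.inner], ?_⟩
  rw [hA']
  simp only [if_true, smul_eq_mul, mul_one] at htr
  rw [htr, one_smul]

/-- The `k`-th element of the flag of density operators attached to an orthonormal basis. -/
noncomputable def flagDensity {u : Fin n → Fin n → ℂ} (hu : IsONB u) (k : Fin n) : Density n :=
  diagDensity hu (fun i => if i ≤ k then ((k : ℝ) + 1)⁻¹ else 0)
    (fun i => by split_ifs <;> positivity)
    (by
      rw [← Finset.sum_filter, Finset.sum_const, Finset.filter_ge_eq_Iic, Fin.card_Iic]
      rw [nsmul_eq_mul]
      push_cast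
      field_simp)

lemma suppLE_flagDensity_iff {u : Fin n → Fin n → ℂ} (hu : IsONB u) (j k : Fin n) :
    suppLE (flagDensity hu j).1 (flagDensity hu k).1 ↔ j ≤ k := by
  have hpos : ∀ k : Fin n, ((k : ℝ) + 1)⁻¹ ≠ 0 := fun k => by positivity
  rw [flagDensity, flagDensity, diagDensity, diagDensity, suppLE_sum_rankOne_iff hu]
  simp only [ite_eq_right_iff, hpos, imp_false, not_le]
  exact ⟨fun h => not_lt.1 fun hlt => absurd (h j hlt) (lt_irrefl j), fun h i hi => h.trans_lt hi⟩

variable {φ : Density n → Density n}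

lemma suppDim_flagDensity
    (hs : ∀ A B, suppLE (φ A).1 (φ B).1 ↔ suppLE A.1 B.1)
    {u : Fin n → Fin n → ℂ} (hu : IsONB u) (k : ℕ) (hk : k < n) :
    suppDim (φ (flagDensity hu ⟨k, hk⟩)).1 = k + 1 := by
  have hlt : ∀ j k : Fin n, j < k →
      suppDim (φ (flagDensity hu j)).1 < suppDim (φ (flagDensity hu k)).1 := by
    intro j k hjk
    apply suppDim_lt
    · rw [hs, suppLE_flagDensity_iff]; exact hjk.le
    · rw [hs, suppLE_flagDensity_iff]; exact not_le.2 hjk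
  have hlow : ∀ (k : ℕ) (hk : k < n), k + 1 ≤ suppDim (φ (flagDensity hu ⟨k, hk⟩)).1 := by
    intro k
    induction k with
    | zero => intro hk; exact one_le_suppDim _
    | succ k ih =>
      intro hk
      have h1 := ih (by omega)
      have h2 := hlt ⟨k, by omega⟩ ⟨k + 1, hk⟩ (by simp [Fin.lt_def])
      omega
  have hup : ∀ (j k : ℕ) (hk : k < n), n = k + 1 + j →
      suppDim (φ (flagDensity hu ⟨k, hk⟩)).1 ≤ k + 1 := by
    intro j
    induction j with
    | zero => intro k hk h; have := suppDim_le (φ (flagDensity hu ⟨k, hk⟩)).1; omega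
    | succ j ih =>
      intro k hk h
      have h1 := ih (k + 1) (by omega) (by omega)
      have h2 := hlt ⟨k, by omega⟩ ⟨k + 1, by omega⟩ (by simp [Fin.lt_def])
      omega
  exact le_antisymm (hup (n - (k + 1)) k hk (by omega)) (hlow k hk)

lemma exists_map_rankOne
    (hs : ∀ A B, suppLE (φ A).1 (φ B).1 ↔ suppLE A.1 B.1)
    (x : Fin n → ℂ) (hx : star x ⬝ᵥ x = 1) :
    ∃ y, star y ⬝ᵥ y = 1 ∧ (φ (rankOneDensity x hx)).1 = rankOne y := by
  cases n with
  | zero => simp [dotProduct] at hx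
  | succ m =>
    obtain ⟨u, hu, hux⟩ := exists_onb_rankOne hx
    have h : flagDensity hu 0 = rankOneDensity x hx := by
      apply Subtype.ext
      show ∑ i, _ • rankOne (u i) = rankOne x
      rw [Finset.sum_eq_single 0]
      · simp [hux]
      · intro j _ hj
        simp [hj]
      · simp
    rw [← h]
    exact exists_eq_rankOne_of_suppDim _ (suppDim_flagDensity hs hu 0 (by omega))

lemma surjective_map
    (hs : ∀ A B, suppLE (φ A).1 (φ B).1 ↔ suppLE A.1 B.1)
    {B : Density n} (hB : ∀ x, ∃ y, B.1 *ᵥ y = x) (x : Fin n → ℂ) :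
    ∃ y, (φ B).1 *ᵥ y = x := by
  cases n with
  | zero => exact ⟨0, Subsingleton.elim _ _⟩
  | succ m =>
    obtain ⟨u, l, hu, -⟩ := B.2.1.exists_spectral
    have h1 : suppLE (flagDensity hu (Fin.last m)).1 B.1 := suppLE_iff.2 fun x => hB _
    have h2 : LinearMap.range (Matrix.toLin' (φ (flagDensity hu (Fin.last m))).1) = ⊤ :=
      Submodule.eq_top_of_finrank_eq
        ((suppDim_flagDensity hs hu m (by omega)).trans (by simp))
    have h3 := (hs _ _).2 h1
    rw [suppLE, h2, top_le_iff] at h3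
    obtain ⟨y, hy⟩ := h3.ge (Submodule.mem_top (x := x))
    exact ⟨y, by simpa using hy⟩

end chain

section wigner

variable {n : ℕ} {T : Matrix (Fin n) (Fin n) ℂ →ₗ[ℂ] Matrix (Fin n) (Fin n) ℂ}

lemma rankOne_mul_eq_zero {y z : Fin n → ℂ} (h : (rankOne y * rankOne z).trace = 0) :
    rankOne y * rankOne z = 0 := by
  rw [rankOne_mul_rankOne, trace_smul, trace_vecMulVec, dotProduct_comm y, smul_eq_mul] at h
  have h1 : star z ⬝ᵥ y = star (star y ⬝ᵥ z) := by rw [star_dotProduct]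
  have h2 : star y ⬝ᵥ z = 0 := by
    rw [h1] at h
    rcases mul_eq_zero.1 h with h | h
    · exact h
    · exact star_eq_zero.1 h
  rw [rankOne_mul_rankOne, h2, zero_smul]

lemma map_sq_of_isHermitian
    (hT : ∀ x, star x ⬝ᵥ x = 1 → ∃ y, star y ⬝ᵥ y = 1 ∧ T (rankOne x) = rankOne y)
    (hI : ∀ x y, star x ⬝ᵥ x = 1 → star y ⬝ᵥ y = 1 →
      (T (rankOne x) * T (rankOne y)).trace = (rankOne x * rankOne y).trace)
    {A : Matrix (Fin n) (Fin n) ℂ} (hA : A.IsHermitian) : T (A * A) = T A * T A := by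
  obtain ⟨u, l, hu, he, hA2, -⟩ := hA.exists_spectral
  have hu1 : ∀ i, star (u i) ⬝ᵥ u i = 1 := fun i => by simp [hu.inner]
  have h1 : ∀ i j, T (rankOne (u i)) * T (rankOne (u j)) =
      if i = j then T (rankOne (u i)) else 0 := by
    intro i j
    obtain ⟨y, hy, hTy⟩ := hT (u i) (hu1 i)
    split_ifs with hij
    · subst hij
      rw [hTy, rankOne_mul_rankOne, hy, one_smul]
      rfl
    · obtain ⟨z, hz, hTz⟩ := hT (u j) (hu1 j)
      have := hI _ _ (hu1 i) (hu1 j)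
      rw [rankOne_mul_rankOne, hu.inner, if_neg hij, zero_smul, trace_zero, hTy, hTz] at this
      rw [hTy, hTz, rankOne_mul_eq_zero this]
  have h2 : A * A = ∑ i, ((l i : ℂ) * l i) • rankOne (u i) :=
    hu.ext fun i => by
      rw [hu.sum_smul_mulVec, ← mulVec_mulVec, he, mulVec_smul, he, smul_smul]
  rw [h2]
  conv_rhs => rw [hA2]
  simp only [map_sum, map_smul, Finset.sum_mul_sum, smul_mul_smul, h1, smul_ite, smul_zero]
  simp

lemma map_jordan
    (hT : ∀ x, star x ⬝ᵥ x = 1 → ∃ y, star y ⬝ᵥ y = 1 ∧ T (rankOne x) = rankOne y)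
    (hI : ∀ x y, star x ⬝ᵥ x = 1 → star y ⬝ᵥ y = 1 →
      (T (rankOne x) * T (rankOne y)).trace = (rankOne x * rankOne y).trace)
    (A B : Matrix (Fin n) (Fin n) ℂ) : T (A * B + B * A) = T A * T B + T B * T A := by
  have h0 : ∀ x y : Fin n → ℂ, T (rankOne x * rankOne y + rankOne y * rankOne x) =
      T (rankOne x) * T (rankOne y) + T (rankOne y) * T (rankOne x) := by
    intro x y
    have h1 := map_sq_of_isHermitian hT hI (rankOne_isHermitian x)
    have h2 := map_sq_of_isHermitian hT hI (rankOne_isHermitian y)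
    have h3 := map_sq_of_isHermitian hT hI ((rankOne_isHermitian x).add (rankOne_isHermitian y))
    rw [add_mul, mul_add, mul_add, map_add, map_add, map_add, map_add, h1, h2] at h3
    rw [map_add]
    have h4 := congrArg (fun M => M - T (rankOne x) * T (rankOne x) -
      T (rankOne y) * T (rankOne y)) h3
    convert h4 using 1
    · abel
    · noncomm_ring
  have hA : A ∈ Submodule.span ℂ {M | ∃ x, star x ⬝ᵥ x = 1 ∧ M = rankOne x} := by
    rw [span_rankOne_eq_top]; trivial
  have hB : B ∈ Submodule.span ℂ {M | ∃ x, star x ⬝ᵥ x = 1 ∧ M = rankOne x} := by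
    rw [span_rankOne_eq_top]; trivial
  induction hA using Submodule.span_induction with
  | zero => simp
  | add A A' _ _ h h' =>
    rw [add_mul, mul_add, map_add T A, add_mul, mul_add, add_add_add_comm, map_add, h, h']
    abel
  | smul c A _ h => simp only [smul_mul_assoc, mul_smul_comm, ← smul_add, map_smul, h]
  | mem A hA =>
    obtain ⟨x, -, rfl⟩ := hA
    induction hB using Submodule.span_induction with
    | zero => simp
    | add A A' _ _ h h' =>
      rw [add_mul, mul_add, map_add T A, add_mul, mul_add, add_add_add_comm, map_add, h, h']
      abel
    | smul c A _ h => simp only [smul_mul_assoc, mul_smul_comm, ← smul_add, map_smul, h]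
    | mem A hA =>
      obtain ⟨y, -, rfl⟩ := hA
      exact h0 x y

lemma map_conjTranspose_of_rankOne
    (hT : ∀ x, star x ⬝ᵥ x = 1 → ∃ y, star y ⬝ᵥ y = 1 ∧ T (rankOne x) = rankOne y)
    (A : Matrix (Fin n) (Fin n) ℂ) : T Aᴴ = (T A)ᴴ := by
  have hA : A ∈ Submodule.span ℂ {M | ∃ x, star x ⬝ᵥ x = 1 ∧ M = rankOne x} := by
    rw [span_rankOne_eq_top]; trivial
  induction hA using Submodule.span_induction with
  | zero => simp
  | add A A' _ _ h h' => simp [h, h']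
  | smul c A _ h => simp [h]
  | mem A hA =>
    obtain ⟨x, hx, rfl⟩ := hA
    obtain ⟨y, hy, h⟩ := hT x hx
    rw [(rankOne_isHermitian x).eq, h, (rankOne_isHermitian y).eq]

lemma trace_map_of_rankOne
    (hT : ∀ x, star x ⬝ᵥ x = 1 → ∃ y, star y ⬝ᵥ y = 1 ∧ T (rankOne x) = rankOne y)
    (A : Matrix (Fin n) (Fin n) ℂ) : (T A).trace = A.trace := by
  have hA : A ∈ Submodule.span ℂ {M | ∃ x, star x ⬝ᵥ x = 1 ∧ M = rankOne x} := by
    rw [span_rankOne_eq_top]; trivial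
  induction hA using Submodule.span_induction with
  | zero => simp
  | add A A' _ _ h h' => simp [h, h']
  | smul c A _ h => simp [h]
  | mem A hA =>
    obtain ⟨x, hx, rfl⟩ := hA
    obtain ⟨y, hy, h⟩ := hT x hx
    rw [h, trace_rankOne, trace_rankOne, hx, hy]

/-- The linear map `x ↦ T (x ⊗ e)`. -/
noncomputable def columnMap (T : Matrix (Fin n) (Fin n) ℂ →ₗ[ℂ] Matrix (Fin n) (Fin n) ℂ)
    (e : Fin n → ℂ) : (Fin n → ℂ) →ₗ[ℂ] Matrix (Fin n) (Fin n) ℂ where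
  toFun x := T (vecMulVec x (star e))
  map_add' x y := by rw [add_vecMulVec, map_add]
  map_smul' c x := by rw [smul_vecMulVec, map_smul]; rfl

lemma columnMap_apply (e x : Fin n → ℂ) : columnMap T e x = T (vecMulVec x (star e)) := rfl

lemma exists_unitary_of_columnMap_eq
    (hJ : ∀ A B, T (A * B + B * A) = T A * T B + T B * T A)
    (hS : ∀ A, T Aᴴ = (T A)ᴴ) (htr : ∀ A, (T A).trace = A.trace)
    {e f : Fin n → ℂ} (he : star e ⬝ᵥ e = 1) (hf : star f ⬝ᵥ f = 1)
    (hTe : T (rankOne e) = rankOne f)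
    (hN : ∀ x, star e ⬝ᵥ x = 0 →
      columnMap T e x = vecMulVec (columnMap T e x *ᵥ f) (star f)) :
    ∃ U ∈ Matrix.unitaryGroup (Fin n) ℂ, ∀ A, T A = U * A * star U := by
  set V : (Fin n → ℂ) → (Fin n → ℂ) := fun x => columnMap T e x *ᵥ f with hV
  have hN' : ∀ x, columnMap T e x = vecMulVec (V x) (star f) := by
    intro x
    have h1 : star e ⬝ᵥ (x - (star e ⬝ᵥ x) • e) = 0 := by
      rw [dotProduct_sub, dotProduct_smul, he]; simp
    have h2 := hN _ h1
    have h3 : columnMap T e e = vecMulVec f (star f) := hTe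
    have h4 : x = (x - (star e ⬝ᵥ x) • e) + (star e ⬝ᵥ x) • e := by simp
    simp only [hV]
    rw [h4, map_add, h2, map_smul, h3, add_mulVec, add_vecMulVec, vecMulVec_mulVec, hf,
      smul_mulVec, vecMulVec_mulVec, hf]
    simp [smul_vecMulVec]
  have hR : ∀ x, T (vecMulVec e (star x)) = vecMulVec f (star (V x)) := by
    intro x
    have : vecMulVec e (star x) = (vecMulVec x (star e))ᴴ := by simp [conjTranspose_vecMulVec]
    rw [this, hS, ← columnMap_apply, hN', conjTranspose_vecMulVec, star_star]
  have h5 : ∀ x y, T (vecMulVec x (star y)) + (star y ⬝ᵥ x) • rankOne f =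
      vecMulVec (V x) (star (V y)) + (star (V y) ⬝ᵥ V x) • rankOne f := by
    intro x y
    have := hJ (vecMulVec x (star e)) (vecMulVec e (star y))
    rw [hR, ← columnMap_apply, hN'] at this
    simpa only [vecMulVec_mul_vecMulVec, he, hf, one_smul, map_add, vecMulVec_smul, map_smul,
      ← rankOne.eq_1, hTe] using this
  have h6 : ∀ x y, star (V y) ⬝ᵥ V x = star y ⬝ᵥ x := by
    intro x y
    have := congrArg trace (h5 x y)
    simp only [trace_add, trace_smul, htr, trace_vecMulVec, trace_rankOne, hf, smul_eq_mul,
      mul_one, dotProduct_comm _ (star _)] at this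
    linear_combination (-1/2) * this
  have h7 : ∀ x y, T (vecMulVec x (star y)) = vecMulVec (V x) (star (V y)) := by
    intro x y
    have := h5 x y
    rw [h6] at this
    exact add_right_cancel this
  set U : Matrix (Fin n) (Fin n) ℂ := of fun i j => V (Pi.single j 1) i with hU
  have hUj : ∀ j, U *ᵥ Pi.single j 1 = V (Pi.single j 1) := by
    intro j; ext i; simp [hU]
  refine ⟨U, ?_, fun A => ?_⟩
  · rw [mem_unitaryGroup_iff']
    ext i j
    have := h6 (Pi.single j 1) (Pi.single i 1)
    simp only [mul_apply, star_apply, hU, of_apply]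
    simp only [dotProduct, Pi.star_apply] at this
    rw [this]
    simp [one_apply, Pi.single_apply]
    grind
  · rw [matrix_eq_sum_single A, map_sum, Finset.mul_sum, Finset.sum_mul]
    refine Finset.sum_congr rfl fun i _ => ?_
    rw [map_sum, Finset.mul_sum, Finset.sum_mul]
    refine Finset.sum_congr rfl fun j _ => ?_
    have : single i j (A i j) =
        A i j • vecMulVec (Pi.single i (1:ℂ)) (star (Pi.single j (1 : ℂ))) := by
      ext a b
      simp [single_apply, vecMulVec_apply, Pi.single_apply]
      grind
    rw [this, map_smul, h7, mul_smul_comm, smul_mul_assoc, mul_vecMulVec, vecMulVec_mul, hUj,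
      star_eq_conjTranspose, ← star_mulVec, hUj]

lemma columnMap_dichotomy
    (hJ : ∀ A B, T (A * B + B * A) = T A * T B + T B * T A)
    {e f : Fin n → ℂ} (he : star e ⬝ᵥ e = 1)
    (hTe : T (rankOne e) = rankOne f) {x : Fin n → ℂ} (hx : star e ⬝ᵥ x = 0) :
    columnMap T e x =
      vecMulVec (columnMap T e x *ᵥ f) (star f) + vecMulVec f (star f ᵥ* columnMap T e x) ∧
    (columnMap T e x *ᵥ f = 0 ∨ star f ᵥ* columnMap T e x = 0) := by
  set N := columnMap T e x with hN
  have h1 : N * rankOne f + rankOne f * N = N := by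
    have := hJ (vecMulVec x (star e)) (vecMulVec e (star e))
    rw [vecMulVec_mul_vecMulVec, vecMulVec_mul_vecMulVec, he, hx] at this
    simp only [one_smul, zero_smul, vecMulVec_zero, add_zero] at this
    rw [← rankOne.eq_1, hTe, ← columnMap_apply, ← hN] at this
    exact this.symm
  have h2 : N * N = 0 := by
    have := hJ (vecMulVec x (star e)) (vecMulVec x (star e))
    rw [vecMulVec_mul_vecMulVec, hx] at this
    simp only [zero_smul, vecMulVec_zero, add_zero, map_zero] at this
    rw [← columnMap_apply, ← hN, ← two_smul ℂ] at this
    exact (smul_eq_zero.1 this.symm).resolve_left two_ne_zero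
  have h4 : N * rankOne f * N = 0 := by
    have h := congrArg (N * ·) h1
    simpa [mul_add, ← mul_assoc, h2] using h
  rw [rankOne, mul_vecMulVec, vecMulVec_mul] at h4
  rw [rankOne, mul_vecMulVec, vecMulVec_mul] at h1
  refine ⟨h1.symm, ?_⟩
  exact vecMulVec_eq_zero.1 h4

lemma exists_unitary_of_linear
    (hT : ∀ x, star x ⬝ᵥ x = 1 → ∃ y, star y ⬝ᵥ y = 1 ∧ T (rankOne x) = rankOne y)
    (hI : ∀ x y, star x ⬝ᵥ x = 1 → star y ⬝ᵥ y = 1 →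
      (T (rankOne x) * T (rankOne y)).trace = (rankOne x * rankOne y).trace) :
    ∃ U ∈ Matrix.unitaryGroup (Fin n) ℂ,
      (∀ A, T A = U * A * star U) ∨ (∀ A, T A = U * Aᵀ * star U) := by
  cases n with
  | zero => exact ⟨1, one_mem _, Or.inl fun A => Subsingleton.elim _ _⟩
  | succ m =>
  have hJ := map_jordan hT hI
  have hS := map_conjTranspose_of_rankOne hT
  have htr := trace_map_of_rankOne hT
  set e : Fin (m + 1) → ℂ := Pi.single 0 1 with he_def
  have he : star e ⬝ᵥ e = 1 := by simp [he_def]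
  have hes : star e = e := by simp [he_def, Pi.star_single]
  obtain ⟨f, hf, hTe⟩ := hT e he
  let E : Submodule ℂ (Fin (m + 1) → ℂ) :=
    { carrier := {x | star e ⬝ᵥ x = 0}
      add_mem' := fun {a b} ha hb => by
        simp only [Set.mem_ofPred_eq] at *; rw [dotProduct_add, ha, hb, add_zero]
      zero_mem' := by simp
      smul_mem' := fun c x hx => by
        simp only [Set.mem_ofPred_eq] at *; rw [dotProduct_smul, hx, smul_zero] }
  have hd := fun x (hx : x ∈ E) => columnMap_dichotomy hJ he hTe (x := x) hx
  have hcases : (∀ x ∈ E, star f ᵥ* columnMap T e x = 0) ∨ (∀ x ∈ E, columnMap T e x *ᵥ f = 0) := by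
    by_contra! hcon
    obtain ⟨⟨x, hx, hx0⟩, ⟨y, hy, hy0⟩⟩ := hcon
    have hx1 := (hd x hx).2.resolve_right hx0
    have hy1 := (hd y hy).2.resolve_left hy0
    rcases (hd (x + y) (E.add_mem hx hy)).2 with h | h
    · rw [map_add, add_mulVec, hx1, zero_add] at h
      exact hy0 h
    · rw [map_add, vecMul_add, hy1, add_zero] at h
      exact hx0 h
  rcases hcases with hc | hc
  · obtain ⟨U, hU, h⟩ := exists_unitary_of_columnMap_eq hJ hS htr he hf hTe fun x hx => by
      have := (hd x hx).1
      rwa [hc x hx, vecMulVec_zero, add_zero] at this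
    exact ⟨U, hU, Or.inl h⟩
  · let T' : Matrix (Fin (m + 1)) (Fin (m + 1)) ℂ →ₗ[ℂ] Matrix (Fin (m + 1)) (Fin (m + 1)) ℂ :=
      (transposeLinearEquiv (Fin (m + 1)) (Fin (m + 1)) ℂ ℂ).toLinearMap ∘ₗ T
    have hT' : ∀ A, T' A = (T A)ᵀ := fun A => rfl
    have hcol : ∀ x, columnMap T' e x = (columnMap T e x)ᵀ := fun x => rfl
    obtain ⟨U, hU, h⟩ := exists_unitary_of_columnMap_eq (T := T') (e := e) (f := star f)
      (fun A B => by
        rw [hT', hT', hT', hJ, transpose_add, transpose_mul, transpose_mul, add_comm (_ * _)])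
      (fun A => by rw [hT', hT', hS]; rfl) (fun A => by rw [hT', trace_transpose, htr]) he
      (by rw [star_star, dotProduct_comm, hf])
      (by rw [hT', hTe, rankOne, rankOne, transpose_vecMulVec, star_star])
      fun x hx => by
        have := (hd x hx).1
        rw [hc x hx, zero_vecMulVec, zero_add] at this
        rw [hcol, mulVec_transpose]
        conv_lhs => rw [this, transpose_vecMulVec]
        rw [star_star]
    refine ⟨Uᵀᴴ, ?_, Or.inr fun A => ?_⟩
    · rw [mem_unitaryGroup_iff] at hU ⊢
      have := congrArg transpose hU
      rw [transpose_mul, transpose_one] at this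
      rw [star_eq_conjTranspose, conjTranspose_conjTranspose]
      exact this
    · have := congrArg transpose (h A)
      rw [hT', transpose_transpose, transpose_mul, transpose_mul] at this
      rw [this, mul_assoc, star_eq_conjTranspose, star_eq_conjTranspose,
        conjTranspose_conjTranspose]
      rfl

end wigner

/-- The properties of `f₀²` used in the proof, where `f` is positive, strictly decreasing,
strictly convex and blows up at `0`. -/
structure IsBarrier (h : ℝ → ℝ) : Prop where
  anti : StrictAntiOn h (Set.Ioi 0)
  conv : StrictConvexOn ℝ (Set.Ioi 0) h
  pos : ∀ t, 0 < t → 0 < h t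
  zero : h 0 = 0
  unbounded : ∀ M δ : ℝ, 0 < δ → ∃ t, 0 < t ∧ t < δ ∧ M < h t

lemma isBarrier_extZero_sq {f : ℝ → ℝ} (hf_pos : ∀ x ∈ Set.Ioi (0:ℝ), 0 < f x)
    (hf_anti : StrictAntiOn f (Set.Ioi 0)) (hf_conv : StrictConvexOn ℝ (Set.Ioi 0) f)
    (hf_lim : Filter.Tendsto f (nhdsWithin 0 (Set.Ioi 0)) Filter.atTop) :
    IsBarrier fun t => extZero f t ^ 2 := by
  have hp : ∀ t, 0 < t → extZero f t = f t := fun t ht => if_pos ht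
  refine ⟨?_, ⟨convex_Ioi 0, ?_⟩, ?_, ?_, ?_⟩
  · intro s hs t ht hst
    simp only [hp s hs, hp t ht]
    have := hf_anti hs ht hst
    have := hf_pos t ht
    gcongr
  · intro s hs t ht hst a b ha hb hab
    have h1 := hf_conv.2 hs ht hst ha hb hab
    have hmem : a • s + b • t ∈ Set.Ioi (0:ℝ) := convex_Ioi 0 hs ht ha.le hb.le hab
    have h2 := hf_pos _ hmem
    have h3 := hf_pos s hs
    have h4 := hf_pos t ht
    simp only [hp s hs, hp t ht, hp _ hmem]
    simp only [smul_eq_mul] at *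
    have h5 : f (a * s + b * t) ^ 2 < (a * f s + b * f t) ^ 2 := by gcongr
    have h6 : (a * f s + b * f t) ^ 2 ≤ a * f s ^ 2 + b * f t ^ 2 := by
      have : b = 1 - a := by linarith
      subst this
      nlinarith [mul_nonneg (mul_nonneg ha.le hb.le) (sq_nonneg (f s - f t))]
    linarith
  · intro t ht
    simp only [hp t ht]
    have := hf_pos t ht
    positivity
  · simp [extZero]
  · intro M δ hδ
    have h1 := hf_lim.eventually (Filter.eventually_gt_atTop (max M 1))
    have h2 : ∀ᶠ t in nhdsWithin (0:ℝ) (Set.Ioi 0), t ∈ Set.Ioo 0 δ := Ioo_mem_nhdsGT hδ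
    obtain ⟨t, h1, h2⟩ := (h1.and h2).exists
    refine ⟨t, h2.1, h2.2, ?_⟩
    simp only [hp t h2.1]
    have h3 : M < f t := lt_of_le_of_lt (le_max_left _ _) h1
    have h4 : 1 < f t := lt_of_le_of_lt (le_max_right _ _) h1
    nlinarith

namespace IsBarrier

variable {h : ℝ → ℝ}

lemma injOn (hh : IsBarrier h) : Set.InjOn h (Set.Ici 0) := by
  intro s hs t ht hst
  rcases eq_or_lt_of_le (show (0:ℝ) ≤ s from hs) with rfl | hs'
  · rcases eq_or_lt_of_le (show (0:ℝ) ≤ t from ht) with rfl | ht'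
    · rfl
    · have := hh.pos t ht'
      rw [hh.zero] at hst
      linarith
  · rcases eq_or_lt_of_le (show (0:ℝ) ≤ t from ht) with rfl | ht'
    · have := hh.pos s hs'
      rw [hh.zero] at hst
      linarith
    · exact hh.anti.injOn hs' ht' hst

lemma le_of_eq (hh : IsBarrier h) {a b c ν : ℝ}
    (ha : 0 < a) (hb : 0 < b) (hc : 0 < c) (h0 : 0 ≤ ν) (h1 : ν ≤ 1)
    (he : h c = (1 - ν) * h b + ν * h a) : c ≤ (1 - ν) * b + ν * a := by
  by_contra! hlt
  have hmem : (1 - ν) * b + ν * a ∈ Set.Ioi (0:ℝ) :=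
    convex_Ioi 0 (Set.mem_Ioi.2 hb) (Set.mem_Ioi.2 ha) (by linarith) h0 (by ring)
  have h2 := hh.anti hmem hc hlt
  have h3 := hh.conv.convexOn.2 (Set.mem_Ioi.2 hb) (Set.mem_Ioi.2 ha)
    (show 0 ≤ 1 - ν by linarith) h0 (by ring)
  simp only [smul_eq_mul] at h3
  linarith

lemma eq_zero_or_one (hh : IsBarrier h) {a b c ν : ℝ}
    (ha : 0 < a) (hb : 0 < b) (h0 : 0 ≤ ν) (h1 : ν ≤ 1)
    (hab : a ≠ b) (he : h c = (1 - ν) * h b + ν * h a) (hc : c = (1 - ν) * b + ν * a) :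
    ν = 0 ∨ ν = 1 := by
  by_contra! hcon
  have h3 := hh.conv.2 (Set.mem_Ioi.2 hb) (Set.mem_Ioi.2 ha) hab.symm
    (show 0 < 1 - ν from sub_pos.2 (lt_of_le_of_ne h1 hcon.2))
    (lt_of_le_of_ne h0 hcon.1.symm) (by ring)
  simp only [smul_eq_mul] at h3
  rw [hc] at he
  linarith

lemma nonneg_of_forall (hh : IsBarrier h) {m : ℕ} {ν : ℝ}
    (hν : ∀ a b : ℝ, 0 < a → 0 < b → a + (m + 1) * b = 1 → 0 ≤ (1 - ν) * h b + ν * h a) :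
    0 ≤ ν ∧ ν ≤ 1 := by
  have hm : (0 : ℝ) < m + 2 := by positivity
  have hm1 : (0 : ℝ) < m + 1 := by positivity
  set c : ℝ := (m + 2 : ℝ)⁻¹ with hc
  have hc0 : 0 < c := by positivity
  have hcm : (m + 2) * c = 1 := by rw [hc]; field_simp
  have hle : ∀ b, c ≤ b → h b ≤ h c := fun b hb =>
    hh.anti.antitoneOn (Set.mem_Ioi.2 hc0) (Set.mem_Ioi.2 (hc0.trans_le hb)) hb
  have hcp := hh.pos c hc0
  constructor
  · by_contra! hneg
    obtain ⟨a, ha0, ha1, ha2⟩ := hh.unbounded ((1 - ν) * h c / (-ν)) c hc0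
    have hb : c ≤ (1 - a) / (m + 1) := by
      rw [le_div_iff₀ hm1]; nlinarith
    have h1 := hν a ((1 - a) / (m + 1)) ha0 (hc0.trans_le hb) (by field_simp; ring)
    have h2 := hle _ hb
    rw [div_lt_iff₀ (by linarith)] at ha2
    nlinarith
  · by_contra! hneg
    obtain ⟨b, hb0, hb1, hb2⟩ := hh.unbounded (ν * h c / (ν - 1)) c hc0
    have ha : c ≤ 1 - (m + 1) * b := by nlinarith
    have h1 := hν (1 - (m + 1) * b) b (hc0.trans_le ha) hb0 (by ring)
    have h2 := hle _ ha
    rw [div_lt_iff₀ (by linarith)] at hb2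
    nlinarith

end IsBarrier

section pencil

/-- The operator acting as `a` on the range of `N` and as `b` on its complement. -/
noncomputable def pencil {n : ℕ} (N : Matrix (Fin n) (Fin n) ℂ) (a b : ℝ) :
    Matrix (Fin n) (Fin n) ℂ := (b : ℂ) • (1 - N) + (a : ℂ) • N

variable {m : ℕ}

lemma sum_ite_zero (a b : ℝ) : ∑ i : Fin (m + 2), (if i = 0 then a else b) = a + (m + 1) * b := by
  rw [Fin.sum_univ_succ]
  simp [Fin.succ_ne_zero]

lemma pencil_eq_sum {x : Fin (m + 2) → ℂ} {u : Fin (m + 2) → Fin (m + 2) → ℂ} (hu : IsONB u)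
    (hux : rankOne (u 0) = rankOne x) (a b : ℝ) :
    pencil (rankOne x) a b = ∑ i, ((if i = 0 then a else b : ℝ) : ℂ) • rankOne (u i) :=
  hu.ext fun i => by
    rw [hu.sum_smul_mulVec, pencil, ← hux, add_mulVec, smul_mulVec, smul_mulVec, sub_mulVec,
      rankOne_mulVec, hu.inner, one_mulVec]
    by_cases hi : i = 0
    · simp [hi]
    · simp [hi, Ne.symm hi]

/-- The density operator with eigenvalue `a` at `x` and `b` on the complement of `x`. -/
noncomputable def pencilDensity (x : Fin (m + 2) → ℂ) (hx : star x ⬝ᵥ x = 1) (a b : ℝ)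
    (ha : 0 < a) (hb : 0 < b) (hab : a + (m + 1) * b = 1) : Density (m + 2) :=
  ⟨pencil (rankOne x) a b, by
    obtain ⟨u, hu, hux⟩ := exists_onb_rankOne hx
    rw [pencil_eq_sum hu hux, trace_sum_rankOne hu]
    refine ⟨posSemidef_sum_rankOne u fun i => by split_ifs <;> linarith, ?_⟩
    rw [← Complex.ofReal_sum, sum_ite_zero, hab, Complex.ofReal_one]⟩

lemma pencil_surjective {x : Fin (m + 2) → ℂ} (hx : star x ⬝ᵥ x = 1) {a b : ℝ}
    (ha : 0 < a) (hb : 0 < b) (z : Fin (m + 2) → ℂ) :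
    ∃ y, pencil (rankOne x) a b *ᵥ y = z := by
  obtain ⟨u, hu, hux⟩ := exists_onb_rankOne hx
  rw [pencil_eq_sum hu hux]
  refine (exists_mulVec_eq_iff (isHermitian_sum_rankOne u _) hu
    (fun i => hu.sum_smul_mulVec _ i)).2 fun i hi => ?_
  split_ifs at hi <;> linarith

lemma matFun_pencil {x : Fin (m + 2) → ℂ} (hx : star x ⬝ᵥ x = 1) (a b : ℝ) (h : ℝ → ℝ) :
    matFun h (pencil (rankOne x) a b) = pencil (rankOne x) (h a) (h b) := by
  obtain ⟨u, hu, hux⟩ := exists_onb_rankOne hx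
  rw [pencil_eq_sum hu hux, pencil_eq_sum hu hux, matFun_sum_rankOne hu]
  simp only [apply_ite h]

lemma trace_mul_pencil (Z N : Matrix (Fin (m + 2)) (Fin (m + 2)) ℂ) (a b : ℝ) :
    (Z * pencil N a b).trace = b * (Z.trace - (Z * N).trace) + a * (Z * N).trace := by
  simp [pencil, mul_add, mul_sub]

end pencil

section projection

variable {m : ℕ} {h : ℝ → ℝ}

lemma exists_pair (m : ℕ) : ∃ a b a' b' : ℝ, 0 < a ∧ 0 < b ∧ a + (m + 1) * b = 1 ∧ a < b ∧
    0 < a' ∧ 0 < b' ∧ a' + (m + 1) * b' = 1 ∧ b' < a' := by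
  have hm : (0 : ℝ) < m + 2 := by positivity
  refine ⟨1 / (2 * (m + 2)), (1 - 1 / (2 * (m + 2))) / (m + 1),
    1 - (m + 1) * (1 / (2 * (m + 2))), 1 / (2 * (m + 2)), by positivity, ?_,
    by field_simp; ring, ?_, ?_, by positivity, by ring, ?_⟩
  · refine div_pos ?_ (by positivity)
    rw [sub_pos, div_lt_one (by positivity)]
    linarith
  · field_simp; nlinarith
  · field_simp; linarith
  · field_simp; linarith

lemma pencil_eigen (hh : IsBarrier h) {N : Matrix (Fin (m + 2)) (Fin (m + 2)) ℂ}
    (hN : ∀ a b : ℝ, 0 < a → 0 < b → a + (m + 1) * b = 1 → (pencil N (h a) (h b)).PosSemidef)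
    {v : Fin (m + 2) → ℂ} (hv : star v ⬝ᵥ v = 1) {ν : ℝ} (hν : N *ᵥ v = (ν : ℂ) • v) :
    0 ≤ ν ∧ ν ≤ 1 := by
  refine hh.nonneg_of_forall (m := m) fun a b ha hb hab => ?_
  have h1 := (hN a b ha hb hab).dotProduct_mulVec_nonneg v
  rw [pencil, add_mulVec, smul_mulVec, smul_mulVec, sub_mulVec, one_mulVec, hν] at h1
  simp only [dotProduct_add, dotProduct_smul, dotProduct_sub, hv, smul_eq_mul, mul_one] at h1
  have h2 : (0 : ℂ) ≤ (((1 - ν) * h b + ν * h a : ℝ) : ℂ) := by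
    push_cast
    convert h1 using 1
    ring
  exact_mod_cast h2

lemma isProjection_of_pencil (hh : IsBarrier h) {N : Matrix (Fin (m + 2)) (Fin (m + 2)) ℂ}
    (hN : ∀ a b : ℝ, 0 < a → 0 < b → a + (m + 1) * b = 1 → ∃ C : Density (m + 2),
      (∀ z, ∃ y, C.1 *ᵥ y = z) ∧ matFun h C.1 = pencil N (h a) (h b) ∧
        (matFun h C.1).PosSemidef) :
    N.IsHermitian ∧ N * N = N ∧ N.trace = 1 := by
  have hpsd : ∀ a b : ℝ, 0 < a → 0 < b → a + (m + 1) * b = 1 →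
      (pencil N (h a) (h b)).PosSemidef := fun a b ha hb hab => by
    obtain ⟨C, -, h1, h2⟩ := hN a b ha hb hab
    rwa [← h1]
  have main : ∀ a b : ℝ, 0 < a → 0 < b → a + (m + 1) * b = 1 → a ≠ b →
      ∃ (u : Fin (m + 2) → Fin (m + 2) → ℂ) (ν c : Fin (m + 2) → ℝ), IsONB u ∧
        N = ∑ i, (ν i : ℂ) • rankOne (u i) ∧ (∀ i, 0 ≤ ν i ∧ ν i ≤ 1) ∧
        (∀ i, h (c i) = (1 - ν i) * h b + ν i * h a) ∧ (∀ i, c i ≤ (1 - ν i) * b + ν i * a) ∧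
        ∑ i, c i = 1 := by
    intro a b ha hb hab hne
    obtain ⟨C, hC, hK, -⟩ := hN a b ha hb hab
    obtain ⟨u, c, hu, hc, he, hA, -⟩ := C.2.1.exists_spectral
    have hc0 : ∀ i, 0 < c i := fun i => by
      refine lt_of_le_of_ne (hc i) fun h0 => ?_
      have := (exists_mulVec_eq_iff C.2.1.isHermitian hu he).1 (hC (u i)) i h0.symm
      rw [hu.inner] at this
      simp at this
    have hhab : h a - h b ≠ 0 := sub_ne_zero.2 fun h0 => hne (hh.anti.injOn ha hb h0)
    have hhab' : (h a : ℂ) - h b ≠ 0 := by exact_mod_cast hhab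
    let ν : Fin (m + 2) → ℝ := fun i => (h (c i) - h b) / (h a - h b)
    have hν : ∀ i, N *ᵥ u i = (ν i : ℂ) • u i := by
      intro i
      have h1 := matFun_mulVec C.2.1.isHermitian (he i) h
      rw [hK, pencil, add_mulVec, smul_mulVec, smul_mulVec, sub_mulVec, one_mulVec] at h1
      have h2 : ((h a : ℂ) - h b) • (N *ᵥ u i) = ((h (c i) : ℂ) - h b) • u i := by
        rw [sub_smul, sub_smul, ← h1, smul_sub]
        abel
      rw [← inv_smul_smul₀ hhab' (N *ᵥ u i), h2, smul_smul]
      congr 1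
      simp only [ν]
      push_cast
      field_simp
    have hν01 : ∀ i, 0 ≤ ν i ∧ ν i ≤ 1 := fun i =>
      pencil_eigen hh hpsd (by simp [hu.inner]) (hν i)
    have heq : ∀ i, h (c i) = (1 - ν i) * h b + ν i * h a := fun i => by
      simp only [ν]
      field_simp
      ring
    refine ⟨u, ν, c, hu, hu.ext fun i => by rw [hν, hu.sum_smul_mulVec], hν01, heq,
      fun i => hh.le_of_eq ha hb (hc0 i) (hν01 i).1 (hν01 i).2 (heq i), ?_⟩
    have htr := C.2.2
    rw [hA, trace_sum_rankOne hu] at htr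
    exact_mod_cast htr
  have sum_eq : ∀ (a b : ℝ) (ν : Fin (m + 2) → ℝ),
      ∑ i, ((1 - ν i) * b + ν i * a) = (m + 2) * b + (a - b) * ∑ i, ν i := by
    intro a b ν
    have : ∀ i, (1 - ν i) * b + ν i * a = b + (a - b) * ν i := fun i => by ring
    simp only [this, Finset.sum_add_distrib, ← Finset.mul_sum]
    simp
  obtain ⟨a, b, a', b', ha, hb, hab, hlt, ha', hb', hab', hlt'⟩ := exists_pair m
  obtain ⟨u, ν, c, hu, hNu, h01, heq, hle, hsum⟩ := main a b ha hb hab hlt.ne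
  obtain ⟨u', ν', c', hu', hNu', -, -, hle', hsum'⟩ := main a' b' ha' hb' hab' hlt'.ne'
  have hνν' : ∑ i, ν' i = ∑ i, ν i := by
    have h1 : N.trace = ((∑ i, ν i : ℝ) : ℂ) := by
      rw [hNu, trace_sum_rankOne hu]; push_cast; rfl
    have h2 : N.trace = ((∑ i, ν' i : ℝ) : ℂ) := by
      rw [hNu', trace_sum_rankOne hu']; push_cast; rfl
    rw [h1] at h2
    exact_mod_cast h2.symm
  have hs1 : ∑ i, ν i ≤ 1 := by
    have := Finset.sum_le_sum fun i (_ : i ∈ Finset.univ) => hle i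
    rw [hsum, sum_eq] at this
    nlinarith
  have hs2 : 1 ≤ ∑ i, ν i := by
    have := Finset.sum_le_sum fun i (_ : i ∈ Finset.univ) => hle' i
    rw [hsum', sum_eq, hνν'] at this
    nlinarith
  have hs : ∑ i, ν i = 1 := le_antisymm hs1 hs2
  have hceq : ∀ i, c i = (1 - ν i) * b + ν i * a := by
    have := (Finset.sum_eq_sum_iff_of_le fun i (_ : i ∈ Finset.univ) => hle i).1
      (by rw [hsum, sum_eq, hs]; linarith)
    exact fun i => this i (Finset.mem_univ i)
  have hν2 : ∀ i, ν i * ν i = ν i := fun i => by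
    rcases hh.eq_zero_or_one ha hb (h01 i).1 (h01 i).2 hlt.ne (heq i) (hceq i) with h | h <;>
      simp [h]
  refine ⟨?_, ?_, ?_⟩
  · rw [hNu]; exact isHermitian_sum_rankOne u ν
  · refine hu.ext fun i => ?_
    have h1 : N *ᵥ u i = (ν i : ℂ) • u i := by
      conv_lhs => rw [hNu]
      exact hu.sum_smul_mulVec _ i
    rw [← mulVec_mulVec, h1, mulVec_smul, h1, smul_smul]
    congr 1
    exact_mod_cast hν2 i
  · rw [hNu, trace_sum_rankOne hu]
    exact_mod_cast hs

lemma eq_rankOne_of_isProjection {n : ℕ} {N : Matrix (Fin n) (Fin n) ℂ} (hN : N.IsHermitian)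
    (hN2 : N * N = N) (htr : N.trace = 1) {y : Fin n → ℂ} (hy : star y ⬝ᵥ y = 1)
    (hNy : (rankOne y * N).trace = 1) : N = rankOne y := by
  rw [trace_rankOne_mul] at hNy
  have h0 : N *ᵥ y - y = 0 := by
    rw [← dotProduct_star_self_eq_zero]
    have : star (N *ᵥ y) ⬝ᵥ N *ᵥ y = 1 := by
      rw [star_mulVec, ← dotProduct_mulVec, mulVec_mulVec, hN.eq, hN2, hNy]
    have h2 : star (N *ᵥ y) ⬝ᵥ y = 1 := by
      rw [star_mulVec, ← dotProduct_mulVec, hN.eq, hNy]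
    rw [star_sub, sub_dotProduct, dotProduct_sub, dotProduct_sub, this, h2, hNy, hy]
    ring
  have h1 : N * rankOne y = rankOne y := by
    rw [rankOne, mul_vecMulVec, sub_eq_zero.1 h0]
  have h2 : rankOne y * N = rankOne y := by
    have := congrArg conjTranspose h1
    rwa [conjTranspose_mul, hN.eq, (rankOne_isHermitian y).eq] at this
  have h3 : rankOne y * rankOne y = rankOne y := by
    rw [rankOne_mul_rankOne, hy, one_smul]; rfl
  have h4 : (N - rankOne y)ᴴ * (N - rankOne y) = N - rankOne y := by
    rw [(hN.sub (rankOne_isHermitian y)).eq, sub_mul, mul_sub, mul_sub, hN2, h1, h2, h3]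
    abel
  have h5 : ((N - rankOne y)ᴴ * (N - rankOne y)).trace = 0 := by
    rw [h4, trace_sub, htr, trace_rankOne, hy, sub_self]
  exact sub_eq_zero.1 (trace_conjTranspose_mul_self_eq_zero_iff.1 h5)

end projection

section preserver

variable {m : ℕ} {h : ℝ → ℝ} {φ : Density (m + 2) → Density (m + 2)}

lemma IsBarrier.posSemidef_matFun {n : ℕ} (hh : IsBarrier h) {B : Matrix (Fin n) (Fin n) ℂ}
    (hB : B.PosSemidef) : (matFun h B).PosSemidef := by
  obtain ⟨u, l, -, hl, -, -, hf⟩ := hB.exists_spectral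
  rw [hf]
  refine posSemidef_sum_rankOne u fun i => ?_
  rcases (hl i).eq_or_lt with h0 | h0
  · rw [← h0, hh.zero]
  · exact (hh.pos _ h0).le

lemma eq_zero_of_trace_mul_matFun (hh : IsBarrier h) {Z : Matrix (Fin (m + 2)) (Fin (m + 2)) ℂ}
    (hZ : ∀ B : Density (m + 2), (∀ z, ∃ y, B.1 *ᵥ y = z) → (Z * matFun h B.1).trace = 0) :
    Z = 0 := by
  have key : ∀ (x : Fin (m + 2) → ℂ), star x ⬝ᵥ x = 1 → ∀ a b : ℝ, 0 < a → 0 < b →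
      a + (m + 1) * b = 1 →
      (h b : ℂ) * (Z.trace - (Z * rankOne x).trace) + h a * (Z * rankOne x).trace = 0 := by
    intro x hx a b ha hb hab
    rw [← trace_mul_pencil, ← matFun_pencil hx]
    exact hZ (pencilDensity x hx a b ha hb hab) (pencil_surjective hx ha hb)
  refine eq_zero_of_trace_rankOne_mul fun x hx => ?_
  rw [trace_mul_comm]
  have hm : (0 : ℝ) < (m + 2 : ℝ)⁻¹ := by positivity
  have h0 := key x hx _ _ hm hm (by field_simp; ring)
  have hne : (h (m + 2 : ℝ)⁻¹ : ℂ) ≠ 0 := by exact_mod_cast (hh.pos _ hm).ne'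
  have htr : Z.trace = 0 := by
    refine (mul_eq_zero.1 (?_ : (h (m + 2 : ℝ)⁻¹ : ℂ) * Z.trace = 0)).resolve_left hne
    linear_combination h0
  obtain ⟨a, b, -, -, ha, hb, hab, hlt, -⟩ := exists_pair m
  have h1 := key x hx a b ha hb hab
  have hne' : (h a : ℂ) - h b ≠ 0 :=
    sub_ne_zero.2 (by exact_mod_cast (hh.anti (Set.mem_Ioi.2 ha) (Set.mem_Ioi.2 hb) hlt).ne')
  refine (mul_eq_zero.1 (?_ : ((h a : ℂ) - h b) * (Z * rankOne x).trace = 0)).resolve_left hne'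
  rw [htr] at h1
  linear_combination h1

lemma exists_linearEquiv_of_trace_eq (hh : IsBarrier h)
    (hq : ∀ x (hx : star x ⬝ᵥ x = 1) (B : Density (m + 2)), (∃ y, B.1 *ᵥ y = x) →
      ((φ (rankOneDensity x hx)).1 * matFun h (φ B).1).trace = (rankOne x * matFun h B.1).trace) :
    ∃ T : Matrix (Fin (m + 2)) (Fin (m + 2)) ℂ ≃ₗ[ℂ] Matrix (Fin (m + 2)) (Fin (m + 2)) ℂ,
      (∀ x (hx : star x ⬝ᵥ x = 1), T (rankOne x) = (φ (rankOneDensity x hx)).1) ∧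
      ∀ B : Density (m + 2), (∀ z, ∃ y, B.1 *ᵥ y = z) → ∀ X,
        (T X * matFun h (φ B).1).trace = (X * matFun h B.1).trace := by
  let ι := {x : Fin (m + 2) → ℂ // star x ⬝ᵥ x = 1}
  let lp := Finsupp.linearCombination ℂ fun i : ι => rankOne i.1
  let lq := Finsupp.linearCombination ℂ fun i : ι => (φ (rankOneDensity i.1 i.2)).1
  have hl : ∀ (v : ι →₀ ℂ) (B : Density (m + 2)), (∀ z, ∃ y, B.1 *ᵥ y = z) →
      (lq v * matFun h (φ B).1).trace = (lp v * matFun h B.1).trace := by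
    intro v B hB
    induction v using Finsupp.induction_linear with
    | zero => simp
    | add v w hv hw => rw [map_add, map_add, add_mul, add_mul, trace_add, trace_add, hv, hw]
    | single i c =>
      simp only [lp, lq, Finsupp.linearCombination_single, smul_mul_assoc, trace_smul]
      rw [hq i.1 i.2 B (hB i.1)]
  have hker : LinearMap.ker lq ≤ LinearMap.ker lp := by
    intro v hv
    rw [LinearMap.mem_ker] at hv ⊢
    refine eq_zero_of_trace_mul_matFun hh fun B hB => ?_
    rw [← hl v B hB, hv, zero_mul, trace_zero]
  obtain ⟨L, hL⟩ := LinearMap.exists_extend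
    ((LinearMap.ker lq).liftQ lp hker ∘ₗ lq.quotKerEquivRange.symm.toLinearMap)
  have hL' : ∀ v, L (lq v) = lp v := by
    intro v
    have h1 := LinearMap.congr_fun hL ⟨lq v, v, rfl⟩
    have h2 : lq.quotKerEquivRange.symm ⟨lq v, v, rfl⟩ = Submodule.Quotient.mk v := by
      rw [LinearEquiv.symm_apply_eq]
      rfl
    simp only [LinearMap.comp_apply, LinearEquiv.coe_coe, h2] at h1
    exact h1
  have hlp : Function.Surjective lp := by
    rw [← LinearMap.range_eq_top, Finsupp.range_linearCombination, ← span_rankOne_eq_top]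
    congr 1
    ext M
    simp [ι, eq_comm]
  have hLs : Function.Surjective L := fun M => by
    obtain ⟨v, rfl⟩ := hlp M
    exact ⟨lq v, hL' v⟩
  let T := (LinearEquiv.ofBijective L ⟨LinearMap.injective_iff_surjective.2 hLs, hLs⟩).symm
  have hT : ∀ v, T (lp v) = lq v := fun v => by
    rw [LinearEquiv.symm_apply_eq]
    exact (hL' v).symm
  refine ⟨T, fun x hx => ?_, fun B hB X => ?_⟩
  · simpa [lp, lq] using hT (Finsupp.single ⟨x, hx⟩ 1)
  · obtain ⟨v, rfl⟩ := hlp X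
    rw [hT, hl v B hB]

lemma trace_map_rankOne_mul (hh : IsBarrier h)
    (hs : ∀ A B, suppLE (φ A).1 (φ B).1 ↔ suppLE A.1 B.1)
    {T : Matrix (Fin (m + 2)) (Fin (m + 2)) ℂ ≃ₗ[ℂ] Matrix (Fin (m + 2)) (Fin (m + 2)) ℂ}
    (hT : ∀ x (hx : star x ⬝ᵥ x = 1), T (rankOne x) = (φ (rankOneDensity x hx)).1)
    (hK : ∀ B : Density (m + 2), (∀ z, ∃ y, B.1 *ᵥ y = z) → ∀ X,
        (T X * matFun h (φ B).1).trace = (X * matFun h B.1).trace)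
    {x : Fin (m + 2) → ℂ} (hx : star x ⬝ᵥ x = 1) (X : Matrix (Fin (m + 2)) (Fin (m + 2)) ℂ) :
    (T X * T (rankOne x)).trace = (X * rankOne x).trace := by
  have hT1 : ∀ x, star x ⬝ᵥ x = 1 → ∃ y, star y ⬝ᵥ y = 1 ∧ T.toLinearMap (rankOne x) = rankOne y :=
    fun x hx => by
      obtain ⟨y, hy, hxy⟩ := exists_map_rankOne hs x hx
      exact ⟨y, hy, (hT x hx).trans hxy⟩
  have htr : ∀ X, (T X).trace = X.trace := trace_map_of_rankOne hT1
  obtain ⟨a, b, -, -, ha, hb, hab, hlt, -⟩ := exists_pair m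
  have hne : (h a : ℂ) - h b ≠ 0 :=
    sub_ne_zero.2 (by exact_mod_cast (hh.anti (Set.mem_Ioi.2 ha) (Set.mem_Ioi.2 hb) hlt).ne')
  have hpen : ∀ a b ha hb hab X,
      (T X * matFun h (φ (pencilDensity x hx a b ha hb hab)).1).trace =
        h b * (X.trace - (X * rankOne x).trace) + h a * (X * rankOne x).trace := by
    intro a b ha hb hab X
    rw [hK _ (pencil_surjective hx ha hb), ← trace_mul_pencil, ← matFun_pencil hx]
    rfl
  obtain ⟨N, hN⟩ : ∃ N, ∀ X, (T X * N).trace = (X * rankOne x).trace := by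
    refine ⟨((h a : ℂ) - h b)⁻¹ •
      (matFun h (φ (pencilDensity x hx a b ha hb hab)).1 - (h b : ℂ) • 1), fun X => ?_⟩
    rw [mul_smul_comm, mul_sub, mul_smul_comm, mul_one, trace_smul, trace_sub, trace_smul, hpen,
      htr, smul_eq_mul, smul_eq_mul]
    field_simp
    ring
  have hproj := isProjection_of_pencil hh (N := N) fun a b ha hb hab => by
    refine ⟨φ (pencilDensity x hx a b ha hb hab), surjective_map hs (pencil_surjective hx ha hb),
      sub_eq_zero.1 (eq_zero_of_trace_rankOne_mul fun y _ => ?_),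
      hh.posSemidef_matFun (φ _).2.1⟩
    obtain ⟨X, hX⟩ := T.surjective (rankOne y)
    rw [← hX, mul_sub, trace_sub, hpen, trace_mul_pencil, htr, hN, sub_self]
  obtain ⟨y, hy, hxy⟩ := hT1 x hx
  have hxy' : T (rankOne x) = rankOne y := hxy
  have hNy : N = rankOne y := by
    refine eq_rankOne_of_isProjection hproj.1 hproj.2.1 hproj.2.2 hy ?_
    rw [← hxy', hN, trace_rankOne_mul, rankOne_mulVec, hx, one_smul, hx]
  rw [hxy', ← hNy, hN]

end preserver

section reconstruction

variable {n : ℕ} {h : ℝ → ℝ}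

lemma trace_rankOne_mul_rankOne_eq_zero_iff {y z : Fin n → ℂ} :
    (rankOne y * rankOne z).trace = 0 ↔ star y ⬝ᵥ z = 0 := by
  rw [trace_rankOne_mul, rankOne_mulVec, dotProduct_smul, smul_eq_mul, mul_eq_zero,
    ← star_eq_zero (x := star z ⬝ᵥ y), ← star_dotProduct_star, star_star, or_self]

lemma exists_mulVec_smul_iff {B : Matrix (Fin n) (Fin n) ℂ} {c : ℂ} (hc : c ≠ 0)
    {z : Fin n → ℂ} : (∃ w, B *ᵥ w = c • z) ↔ ∃ w, B *ᵥ w = z := by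
  constructor
  · rintro ⟨w, hw⟩
    exact ⟨c⁻¹ • w, by rw [mulVec_smul, hw, inv_smul_smul₀ hc]⟩
  · rintro ⟨w, rfl⟩
    exact ⟨c • w, mulVec_smul _ _ _⟩

lemma eq_of_quadForm_matFun_eq (hh : IsBarrier h) {B C : Matrix (Fin n) (Fin n) ℂ}
    (hB : B.PosSemidef) (hC : C.PosSemidef)
    (hr : ∀ z, star z ⬝ᵥ z = 1 → (∃ w, C *ᵥ w = z) → ∃ w, B *ᵥ w = z)
    (hq : ∀ z, star z ⬝ᵥ z = 1 → (∃ w, B *ᵥ w = z) →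
      star z ⬝ᵥ matFun h C *ᵥ z = star z ⬝ᵥ matFun h B *ᵥ z) : C = B := by
  obtain ⟨u, l, hu, hl, he, -, -⟩ := hB.exists_spectral
  have hr' : ∀ w, ∃ w', B *ᵥ w' = C *ᵥ w := by
    intro w
    by_cases hz : C *ᵥ w = 0
    · exact ⟨0, by rw [hz, mulVec_zero]⟩
    · obtain ⟨c, z, hc, hcz, hz1⟩ := exists_unit_smul hz
      rw [hcz, exists_mulVec_smul_iff hc]
      exact hr z hz1 ((exists_mulVec_smul_iff hc).1 ⟨w, hcz⟩)
  have hq' : ∀ z, (∃ w, B *ᵥ w = z) → star z ⬝ᵥ (matFun h C - matFun h B) *ᵥ z = 0 := by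
    intro z hz
    by_cases hz0 : z = 0
    · simp [hz0]
    · obtain ⟨c, y, hc, rfl, hy⟩ := exists_unit_smul hz0
      have := hq y hy ((exists_mulVec_smul_iff hc).1 hz)
      simp only [star_smul, smul_dotProduct, mulVec_smul, dotProduct_smul, sub_mulVec,
        dotProduct_sub, this, sub_self, smul_zero]
  have hCu : ∀ i, l i = 0 → C *ᵥ u i = 0 := by
    intro i hi
    rw [← dotProduct_star_self_eq_zero, star_mulVec, ← dotProduct_mulVec, hC.isHermitian.eq]
    exact (exists_mulVec_eq_iff hB.isHermitian hu he).1 (hr' _) i hi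
  set Q := matFun (fun t => if t = 0 then 0 else 1) B with hQ
  have hQu : ∀ i, Q *ᵥ u i = (((if l i = 0 then 0 else 1 : ℝ)) : ℂ) • u i := fun i =>
    matFun_mulVec hB.isHermitian (he i) _
  have hQh : Q.IsHermitian := matFun_isHermitian _ _
  set Z := matFun h C - matFun h B with hZ
  have hZh : Z.IsHermitian := (matFun_isHermitian _ _).sub (matFun_isHermitian _ _)
  have hZQ : Z * Q = Z := by
    refine hu.ext fun i => ?_
    rw [← mulVec_mulVec, hQu]
    by_cases hi : l i = 0
    · have h1 := matFun_mulVec hB.isHermitian (he i) h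
      have h2 := matFun_mulVec hC.isHermitian (c := 0) (v := u i) (by simp [hCu i hi]) h
      rw [hi] at h1
      simp [hi, hZ, sub_mulVec, h1, h2]
    · simp [hi]
  have hZ0 : Z = 0 := by
    refine eq_zero_of_forall_unit fun x _ => ?_
    have h1 : Q * Z = Z := by
      have := congrArg conjTranspose hZQ
      rwa [conjTranspose_mul, hQh.eq, hZh.eq] at this
    have h2 := hq' (Q *ᵥ x) ((exists_mulVec_eq_iff hB.isHermitian hu he).2 fun i hi => by
      rw [dotProduct_mulVec, ← hQh.eq, ← star_mulVec, hQu]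
      simp [hi])
    rwa [star_mulVec, ← dotProduct_mulVec, mulVec_mulVec, mulVec_mulVec, hQh.eq, h1, hZQ] at h2
  refine hu.ext fun i => ?_
  rw [he]
  refine eigen_of_matFun_mulVec hC (hl i) hh.injOn ?_
  rw [sub_eq_zero.1 hZ0, matFun_mulVec hB.isHermitian (he i)]

lemma map_eq_of_rankOne (hh : IsBarrier h) {φ : Density n → Density n}
    (hs : ∀ A B, suppLE (φ A).1 (φ B).1 ↔ suppLE A.1 B.1)
    (hq : ∀ x (hx : star x ⬝ᵥ x = 1) (B : Density n), (∃ y, B.1 *ᵥ y = x) →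
      ((φ (rankOneDensity x hx)).1 * matFun h (φ B).1).trace = (rankOne x * matFun h B.1).trace)
    {T : Matrix (Fin n) (Fin n) ℂ →ₗ[ℂ] Matrix (Fin n) (Fin n) ℂ}
    (hT : ∀ x (hx : star x ⬝ᵥ x = 1), T (rankOne x) = (φ (rankOneDensity x hx)).1)
    (hI : ∀ x, star x ⬝ᵥ x = 1 → ∀ X, (T X * T (rankOne x)).trace = (X * rankOne x).trace)
    (hsurj : ∀ y, star y ⬝ᵥ y = 1 → ∃ x, star x ⬝ᵥ x = 1 ∧ T (rankOne x) = rankOne y)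
    (B : Density n) : (φ B).1 = T B.1 := by
  obtain ⟨u, l, hu, hl, he, hB, hf⟩ := B.2.1.exists_spectral
  have hu1 : ∀ i, star (u i) ⬝ᵥ u i = 1 := fun i => by simp [hu.inner]
  have hy : ∀ i, ∃ y, star y ⬝ᵥ y = 1 ∧ T (rankOne (u i)) = rankOne y := fun i => by
    rw [hT _ (hu1 i)]
    exact exists_map_rankOne hs _ _
  choose y hy1 hTy using hy
  have hyo : IsONB y := IsONB.of_inner fun i j => by
    by_cases hij : i = j
    · simp [hij, hy1]
    · rw [if_neg hij, ← trace_rankOne_mul_rankOne_eq_zero_iff, ← hTy, ← hTy, hI _ (hu1 j),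
        trace_rankOne_mul_rankOne_eq_zero_iff, hu.inner, if_neg hij]
  have hTB : T B.1 = ∑ i, (l i : ℂ) • rankOne (y i) := by
    conv_lhs => rw [hB]
    simp only [map_sum, map_smul, hTy]
  have hTK : T (matFun h B.1) = matFun h (T B.1) := by
    rw [hTB, matFun_sum_rankOne hyo, hf]
    simp only [map_sum, map_smul, hTy]
  have hTpsd : (T B.1).PosSemidef := by
    rw [hTB]
    exact posSemidef_sum_rankOne y hl
  have hran : ∀ x z, star x ⬝ᵥ x = 1 → T (rankOne x) = rankOne z →
      ((∃ w, T B.1 *ᵥ w = z) ↔ ∃ w, B.1 *ᵥ w = x) := by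
    intro x z hx hxz
    rw [exists_mulVec_eq_iff B.2.1.isHermitian hu he,
      exists_mulVec_eq_iff hTpsd.isHermitian hyo fun i => by rw [hTB, hyo.sum_smul_mulVec]]
    refine forall_congr' fun i => imp_congr_right fun _ => ?_
    rw [← trace_rankOne_mul_rankOne_eq_zero_iff, ← hTy, ← hxz, hI x hx,
      trace_rankOne_mul_rankOne_eq_zero_iff]
  refine eq_of_quadForm_matFun_eq hh hTpsd (φ B).2.1 (fun z hz hw => ?_) fun z hz hw => ?_
  · obtain ⟨x, hx, hxz⟩ := hsurj z hz
    rw [hran x z hx hxz, ← suppLE_rankOne_iff hx]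
    rw [← suppLE_rankOne_iff hz, ← hxz, hT x hx, hs] at hw
    exact hw
  · obtain ⟨x, hx, hxz⟩ := hsurj z hz
    rw [← trace_rankOne_mul, ← trace_rankOne_mul, ← hxz, hT x hx,
      hq x hx B ((hran x z hx hxz).1 hw), ← hT x hx, ← hTK, trace_mul_comm (T _), hI x hx,
      trace_mul_comm]

lemma exists_rankOne_of_unitary {T : Matrix (Fin n) (Fin n) ℂ →ₗ[ℂ] Matrix (Fin n) (Fin n) ℂ}
    {U : Matrix (Fin n) (Fin n) ℂ} (hU : U ∈ unitaryGroup (Fin n) ℂ)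
    (hT : (∀ A, T A = U * A * star U) ∨ (∀ A, T A = U * Aᵀ * star U)) {y : Fin n → ℂ}
    (hy : star y ⬝ᵥ y = 1) : ∃ x, star x ⬝ᵥ x = 1 ∧ T (rankOne x) = rankOne y := by
  have hUU : U * star U = 1 := mem_unitaryGroup_iff.1 hU
  have h1 : star (star U *ᵥ y) ⬝ᵥ star U *ᵥ y = 1 := by
    rw [star_mulVec, ← dotProduct_mulVec, mulVec_mulVec, ← star_eq_conjTranspose, star_star, hUU,
      one_mulVec, hy]
  have h2 : U * rankOne (star U *ᵥ y) * star U = rankOne y := by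
    rw [rankOne, mul_vecMulVec, vecMulVec_mul, mulVec_mulVec, hUU, one_mulVec, star_mulVec,
      vecMul_vecMul, ← star_eq_conjTranspose, star_star, hUU, vecMul_one]
    rfl
  rcases hT with hT | hT
  · exact ⟨_, h1, by rw [hT, h2]⟩
  · refine ⟨star (star U *ᵥ y), by rwa [star_star, dotProduct_comm], ?_⟩
    rw [hT, ← h2]
    congr 2
    rw [rankOne, rankOne, transpose_vecMulVec, star_star]

end reconstruction

section divergence

variable {n : ℕ} {f g : ℝ → ℝ} {φ : Density n → Density n}

lemma suppLE_map_iff (hφ : ∀ A B : Density n, DfgE f g (φ A).1 (φ B).1 = DfgE f g A.1 B.1)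
    (A B : Density n) : suppLE (φ A).1 (φ B).1 ↔ suppLE A.1 B.1 := by
  have key : ∀ A B : Matrix (Fin n) (Fin n) ℂ, DfgE f g A B = ⊤ ↔ ¬ suppLE A B := fun A B => by
    rw [DfgE]
    split_ifs with hAB <;> simp [hAB]
  rw [← not_iff_not, ← key, ← key, hφ]

lemma trace_map_mul_matFun (hg_mono : StrictMonoOn g (Set.Ici 0)) (hg0 : g 0 = 0)
    (hφ : ∀ A B : Density n, DfgE f g (φ A).1 (φ B).1 = DfgE f g A.1 B.1)
    {x : Fin n → ℂ} (hx : star x ⬝ᵥ x = 1) {B : Density n} (hxB : ∃ y, B.1 *ᵥ y = x) :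
    ((φ (rankOneDensity x hx)).1 * matFun (fun t => extZero f t ^ 2) (φ B).1).trace =
      (rankOne x * matFun (fun t => extZero f t ^ 2) B.1).trace := by
  have hs := suppLE_map_iff hφ
  obtain ⟨y, -, hxy⟩ := exists_map_rankOne hs x hx
  have h1 : suppLE (rankOneDensity x hx).1 B.1 := (suppLE_rankOne_iff hx).2 hxB
  have h2 := hφ (rankOneDensity x hx) B
  rw [DfgE, DfgE, if_pos h1, if_pos ((hs _ _).2 h1), EReal.coe_eq_coe_iff, hxy, rankOneDensity,
    Dfg_rankOne f hg0 y (φ B).2.1.isHermitian, Dfg_rankOne f hg0 x B.2.1.isHermitian] at h2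
  obtain ⟨r, hr, hyr⟩ := quadForm_eq_ofReal
    (posSemidef_matFun_sq (φ B).2.1.isHermitian (extZero f)) y
  obtain ⟨s, hs, hxs⟩ := quadForm_eq_ofReal (posSemidef_matFun_sq B.2.1.isHermitian (extZero f)) x
  rw [hyr, hxs, Complex.ofReal_re, Complex.ofReal_re] at h2
  rw [hxy, trace_rankOne_mul, trace_rankOne_mul, hyr, hxs, hg_mono.injOn hr hs h2]

end divergence

/-- Preservers of the generalized divergence `D'_{f,g}`
(case `lim_{ε→0⁺} f(ε) = ∞`) on density operators are unitary or antiunitary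
similarity transformations. -/
theorem stmt1 {n : ℕ}
    (f : ℝ → ℝ) (hf_pos : ∀ x ∈ Set.Ioi (0:ℝ), 0 < f x)
    (hf_anti : StrictAntiOn f (Set.Ioi 0))
    (hf_conv : StrictConvexOn ℝ (Set.Ioi 0) f)
    (hf_lim : Filter.Tendsto f (nhdsWithin 0 (Set.Ioi 0)) Filter.atTop)
    (g : ℝ → ℝ) (hg_nonneg : ∀ x ∈ Set.Ici (0:ℝ), 0 ≤ g x)
    (hg_mono : StrictMonoOn g (Set.Ici 0))
    (hg_cont : ContinuousOn g (Set.Ici 0)) (hg0 : g 0 = 0)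
    (hg_top : Filter.Tendsto g Filter.atTop Filter.atTop)
    (hg_cc : StrictConvexOn ℝ (Set.Ici 0) g ∨ StrictConcaveOn ℝ (Set.Ici 0) g)
    (φ : Density n → Density n)
    (hφ : ∀ A B : Density n, DfgE f g (φ A).1 (φ B).1 = DfgE f g A.1 B.1) :
    ∃ U ∈ Matrix.unitaryGroup (Fin n) ℂ,
      (∀ A : Density n, (φ A).1 = U * A.1 * star U) ∨
      (∀ A : Density n, (φ A).1 = U * A.1ᵀ * star U) := by
  match n with
  | 0 =>
    refine ⟨1, one_mem _, Or.inl fun A => absurd A.2.2 ?_⟩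
    simp
  | 1 =>
    have h1 : ∀ A : Density 1, A.1 = 1 := fun A => by
      have := A.2.2
      rw [trace_fin_one] at this
      ext i j
      rw [Subsingleton.elim i 0, Subsingleton.elim j 0, this, one_apply_eq]
    exact ⟨1, one_mem _, Or.inl fun A => by rw [h1 A, h1 (φ A), star_one, mul_one, mul_one]⟩
  | m + 2 =>
    have hh := isBarrier_extZero_sq hf_pos hf_anti hf_conv hf_lim
    have hs := suppLE_map_iff hφ
    have hq := fun x (hx : star x ⬝ᵥ x = 1) B hxB =>
      trace_map_mul_matFun hg_mono hg0 hφ hx (B := B) hxB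
    obtain ⟨T, hT, hK⟩ := exists_linearEquiv_of_trace_eq hh hq
    have hI := fun x hx => trace_map_rankOne_mul hh hs hT hK (x := x) hx
    have hT1 : ∀ x, star x ⬝ᵥ x = 1 → ∃ y, star y ⬝ᵥ y = 1 ∧
        T.toLinearMap (rankOne x) = rankOne y :=
      fun x hx => by
        obtain ⟨y, hy, hxy⟩ := exists_map_rankOne hs x hx
        exact ⟨y, hy, (hT x hx).trans hxy⟩
    obtain ⟨U, hU, hTU⟩ := exists_unitary_of_linear (T := T.toLinearMap) hT1
      fun x y _ hy => hI y hy _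
    have hφT := map_eq_of_rankOne hh hs hq (T := T.toLinearMap) hT hI
      fun y hy => exists_rankOne_of_unitary hU hTU hy
    refine ⟨U, hU, hTU.imp (fun h A => ?_) fun h A => ?_⟩ <;> rw [hφT, h]
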